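/- Let n₁, n₂ ≥ 1, 1 < p < q < ∞, 0 < β_i < n_i with 1/q = 1/p - β_i/n_i for i = 1,2. For nonnegative f on ℝ^{n₁}×ℝ^{n₂} define 𝓗_{β₁,β₂}(f)(x₁,x₂) = |B(0,|x₁|)|^{-(1-β₁/n₁)} |B(0,|x₂|)|^{-(1-β₂/n₂)} ∫_{|y₁|<|x₁|}∫_{|y₂|<|x₂|} f(y₁,y₂) dy₁dy₂. Then ‖𝓗_{β₁,β₂}(f)‖_{L^q(ℝ^{n₁}×ℝ^{n₂})} ≤ A₁A₂ ‖f‖_{L^p(ℝ^{n₁}×ℝ^{n₂})}, where A_i = (p'/q)^{1/q} ((n_i/(qβ_i)) B(n_i/(qβ_i), n_i/(q'β_i)))^{-β_i/n_i}. -/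

import Mathlib

open MeasureTheory Set
open scoped ENNReal

/-- The Euler Beta function `B(z,w) = ∫₀¹ t^(z-1) (1-t)^(w-1) dt`. -/
noncomputable def betaFn (z w : ℝ) : ℝ :=
  ∫ t in Ioo (0 : ℝ) 1, t ^ (z - 1) * (1 - t) ^ (w - 1)

/-- The two-fold fractional Hardy operator `𝓗_{β₁,β₂}` on `ℝ^{n₁} × ℝ^{n₂}`. -/
noncomputable def prodFracHardy₂ (n₁ n₂ : ℕ) (β₁ β₂ : ℝ)
    (f : EuclideanSpace ℝ (Fin n₁) × EuclideanSpace ℝ (Fin n₂) → ℝ≥0∞)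
    (x : EuclideanSpace ℝ (Fin n₁) × EuclideanSpace ℝ (Fin n₂)) : ℝ≥0∞ :=
  (volume (Metric.ball (0 : EuclideanSpace ℝ (Fin n₁)) ‖x.1‖)) ^ (β₁ / (n₁ : ℝ) - 1) *
  (volume (Metric.ball (0 : EuclideanSpace ℝ (Fin n₂)) ‖x.2‖)) ^ (β₂ / (n₂ : ℝ) - 1) *
    ∫⁻ y in (Metric.ball (0 : EuclideanSpace ℝ (Fin n₁)) ‖x.1‖) ×ˢ
        (Metric.ball (0 : EuclideanSpace ℝ (Fin n₂)) ‖x.2‖), f y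

section
open Filter Topology

theorem hasDerivAt_setIntegral_Iic {w : ℝ → ℝ} (hc : Continuous w) (hi : Integrable w) (x : ℝ) :
    HasDerivAt (fun t => ∫ s in Iic t, w s) (w x) x := by
  have h : (fun t => ∫ s in Iic t, w s) = fun t => (∫ s in Iic 0, w s) + ∫ s in (0 : ℝ)..t, w s := by
    ext t
    rw [← intervalIntegral.integral_Iic_sub_Iic hi.integrableOn hi.integrableOn]
    ring
  rw [h]
  exact (intervalIntegral.integral_hasDerivAt_right (hc.intervalIntegrable _ _)
    (hc.stronglyMeasurableAtFilter _ _) hc.continuousAt).const_add _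

theorem strictMono_setIntegral_Iic {w : ℝ → ℝ} (hc : Continuous w) (hi : Integrable w)
    (hw : ∀ x, 0 < w x) : StrictMono (fun t => ∫ s in Iic t, w s) :=
  strictMono_of_hasDerivAt_pos (fun x => hasDerivAt_setIntegral_Iic hc hi x) hw

theorem tendsto_setIntegral_Iic_atBot {w : ℝ → ℝ} (hi : Integrable w) :
    Tendsto (fun t => ∫ s in Iic t, w s) atBot (𝓝 0) := by
  have h : (fun t => ∫ s in Iic t, w s) = fun t => (∫ s in Iic 0, w s) - ∫ s in t..0, w s := by
    ext t
    rw [← intervalIntegral.integral_Iic_sub_Iic hi.integrableOn hi.integrableOn]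
    ring
  rw [h]
  simpa using (intervalIntegral_tendsto_integral_Iic 0 hi.integrableOn tendsto_id).const_sub
    (∫ s in Iic 0, w s)

theorem tendsto_setIntegral_Iic_atTop {w : ℝ → ℝ} (hi : Integrable w) :
    Tendsto (fun t => ∫ s in Iic t, w s) atTop (𝓝 (∫ s, w s)) :=
  (aecover_Iic tendsto_id).integral_tendsto_of_countably_generated hi

theorem setIntegral_Iic_lt {w : ℝ → ℝ} (hc : Continuous w) (hi : Integrable w)
    (hw : ∀ x, 0 < w x) (t : ℝ) : ∫ s in Iic t, w s < ∫ s, w s :=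
  (strictMono_setIntegral_Iic hc hi hw (lt_add_one t)).trans_le
    ((strictMono_setIntegral_Iic hc hi hw).monotone.ge_of_tendsto
      (tendsto_setIntegral_Iic_atTop hi) _)

theorem setIntegral_Iic_pos {w : ℝ → ℝ} (hc : Continuous w) (hi : Integrable w)
    (hw : ∀ x, 0 < w x) (t : ℝ) : 0 < ∫ s in Iic t, w s :=
  ((strictMono_setIntegral_Iic hc hi hw).monotone.le_of_tendsto
      (tendsto_setIntegral_Iic_atBot hi) _).trans_lt
  (strictMono_setIntegral_Iic hc hi hw (sub_one_lt t))

/-- Two positive densities of equal mass are intertwined by a differentiable transport map. -/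
theorem exists_monotone_transport {w v : ℝ → ℝ} (hwc : Continuous w) (hwi : Integrable w)
    (hw : ∀ x, 0 < w x) (hvc : Continuous v) (hvi : Integrable v) (hv : ∀ x, 0 < v x)
    (h : ∫ s, w s = ∫ s, v s) :
    ∃ θ : ℝ → ℝ, (∀ t, ∫ s in Iic (θ t), v s = ∫ s in Iic t, w s) ∧
      ∀ t, HasDerivAt θ (w t / v (θ t)) t := by
  have hcont : Continuous (fun t => ∫ s in Iic t, v s) :=
    continuous_iff_continuousAt.2 fun x => (hasDerivAt_setIntegral_Iic hvc hvi x).continuousAt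
  have hmono := strictMono_setIntegral_Iic hvc hvi hv
  have hex : ∀ y ∈ Ioo 0 (∫ s, v s), ∃ x, ∫ s in Iic x, v s = y := by
    intro y hy
    obtain ⟨a, ha⟩ := ((tendsto_setIntegral_Iic_atBot hvi).eventually_lt_const hy.1).exists
    obtain ⟨b, hb⟩ := ((tendsto_setIntegral_Iic_atTop hvi).eventually_const_lt hy.2).exists
    exact mem_range_of_exists_le_of_exists_ge hcont ⟨a, ha.le⟩ ⟨b, hb.le⟩
  choose! φ hφ using hex
  have hmem : ∀ t, ∫ s in Iic t, w s ∈ Ioo 0 (∫ s, v s) := fun t =>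
    ⟨setIntegral_Iic_pos hwc hwi hw t, h ▸ setIntegral_Iic_lt hwc hwi hw t⟩
  refine ⟨fun t => φ (∫ s in Iic t, w s), fun t => hφ _ (hmem t), fun t => ?_⟩
  have hev : ∀ᶠ y in 𝓝 (∫ s in Iic t, w s), ∫ s in Iic (φ y), v s = y := by
    filter_upwards [isOpen_Ioo.mem_nhds (hmem t)] with y hy using hφ y hy
  have hφc : ContinuousAt φ (∫ s in Iic t, w s) := by
    refine tendsto_order.2 ⟨fun a ha => ?_, fun a ha => ?_⟩
    · have hlt := hmono ha
      simp only [hev.self_of_nhds] at hlt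
      filter_upwards [eventually_gt_nhds hlt, hev] with y hy hy'
      rw [← hy'] at hy
      exact hmono.lt_iff_lt.1 hy
    · have hlt := hmono ha
      simp only [hev.self_of_nhds] at hlt
      filter_upwards [eventually_lt_nhds hlt, hev] with y hy hy'
      rw [← hy'] at hy
      exact hmono.lt_iff_lt.1 hy
  have hd := (hasDerivAt_setIntegral_Iic hvc hvi _).of_local_left_inverse
    (g := φ) hφc (hv _).ne' hev
  have := hd.comp t (hasDerivAt_setIntegral_Iic hwc hwi t)
  rwa [← div_eq_inv_mul] at this

theorem bliss_calibration {p r g τ : ℝ} {F z θ : ℝ → ℝ} (hp : 1 < p) (hr : 0 < r) (hg : 0 ≤ g)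
    (hF0 : 0 < F τ) (hF : HasDerivAt F (g * Real.exp τ) τ)
    (hz : HasDerivAt z (F τ ^ (p * (r + 1)) * Real.exp (-((p - 1) * (r + 1)) * τ)) τ)
    (hθ : HasDerivAt θ ((F τ ^ (p * (r + 1)) * Real.exp (-((p - 1) * (r + 1)) * τ)) /
      (Real.exp ((r + 1) * θ τ) * (1 + Real.exp (r * θ τ)) ^ (-(p * (r + 1) / r)))) τ) :
    ∃ d, d ≤ (1 + r * (p - 1) / p) * (g ^ p * Real.exp τ) ∧
      HasDerivAt (fun t => F t ^ ((p - 1) * (r + 1) + 1) *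
          Real.exp ((r * (p - 1) / p - (p - 1) * (r + 1)) * t - r * (p - 1) / p * θ t)
        + r * (p - 1) / p * (Real.exp (θ t) * (1 + Real.exp (r * θ t)) ^ (1 - p * (r + 1) / r))
        + (p - 1) * (r + 1) * (1 + r * (p - 1) / p) * z t) d τ := by
  have hp0 : 0 < p := by linarith
  have hp1 : 0 < p - 1 := by linarith
  obtain ⟨φ, hφ⟩ : ∃ φ, F τ = Real.exp φ := ⟨Real.log (F τ), (Real.exp_log hF0).symm⟩
  obtain ⟨u, hu⟩ : ∃ u, 1 + Real.exp (r * θ τ) = Real.exp u :=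
    ⟨Real.log _, (Real.exp_log (by positivity)).symm⟩
  have hU0 : 1 + Real.exp (r * θ τ) ≠ 0 := by positivity
  set ρ := r * (p - 1) / p with hρ
  set κ := (p - 1) * (r + 1) with hκ
  set N := p * (r + 1) / r with hN
  have hρ0 : 0 < ρ := by positivity
  have hκN : κ = N * ρ := by rw [hκ, hN, hρ]; field_simp
  have hN0 : 0 < N := by positivity
  have hN1 : 1 < N := by rw [hN, lt_div_iff₀ hr]; nlinarith
  have hE1 := ((hF.rpow_const (p := κ + 1) (Or.inl hF0.ne')).mul
    ((((hasDerivAt_id τ).const_mul (ρ - κ)).sub (hθ.const_mul ρ)).exp))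
  have hE2 := (hθ.exp.mul (((hθ.const_mul r).exp.const_add 1).rpow_const (p := 1 - N)
    (Or.inl hU0))).const_mul ρ
  have hE := (hE1.add hE2).add (hz.const_mul (κ * (1 + ρ)))
  refine ⟨_, ?_, hE⟩
  obtain ⟨x, hx⟩ : ∃ x, x = p * (r + 1) * φ - κ * τ - (r + 1) * θ τ + N * u := ⟨_, rfl⟩
  have hθ' : F τ ^ (p * (r + 1)) * Real.exp (-κ * τ) /
      (Real.exp ((r + 1) * θ τ) * (1 + Real.exp (r * θ τ)) ^ (-N)) = Real.exp x := by
    rw [hφ, hu, ← Real.exp_mul, ← Real.exp_mul, ← Real.exp_add, ← Real.exp_add, ← Real.exp_sub, hx]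
    ring_nf
  rw [hθ', hφ, hu]
  simp only [id, Pi.sub_apply, ← Real.exp_mul]
  obtain ⟨P, hP⟩ : ∃ P, P = Real.exp (φ * (κ + 1) + (ρ - κ) * τ - ρ * θ τ) := ⟨_, rfl⟩
  obtain ⟨b, hb⟩ : ∃ b, b = Real.exp (φ * κ + (ρ - κ) * τ - ρ * θ τ) := ⟨_, rfl⟩
  obtain ⟨m, hm⟩ : ∃ m, m = Real.exp (φ * (p * (r + 1)) - κ * τ - r * θ τ) := ⟨_, rfl⟩
  have hzm : Real.exp (φ * (p * (r + 1))) * Real.exp (-κ * τ) = m * Real.exp (r * θ τ) := by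
    rw [hm, ← Real.exp_add, ← Real.exp_add]; ring_nf
  have h1 : g * Real.exp τ * (κ + 1) * Real.exp (φ * (κ + 1 - 1)) *
      Real.exp ((ρ - κ) * τ - ρ * θ τ) = (κ + 1) * (g * b) * Real.exp τ := by
    have : b = Real.exp (φ * (κ + 1 - 1)) * Real.exp ((ρ - κ) * τ - ρ * θ τ) := by
      rw [hb, ← Real.exp_add]; ring_nf
    rw [this]; ring
  have hPx : P * Real.exp (x / N) = m * (1 + Real.exp (r * θ τ)) := by
    rw [hP, hm, hu, ← Real.exp_add, ← Real.exp_add]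
    congr 1
    rw [hx, hκ, hρ, hN]
    field_simp
    ring
  have h2 : Real.exp (φ * (κ + 1)) * (Real.exp ((ρ - κ) * τ - ρ * θ τ) *
      ((ρ - κ) * 1 - ρ * Real.exp x)) ≤ - κ * (m * (1 + Real.exp (r * θ τ))) := by
    have hconv : Real.exp (x / N) ≤ (1 - 1 / N) + Real.exp x / N := by
      obtain ⟨-, hcv⟩ := convexOn_exp
      have := @hcv 0 (mem_univ _) x (mem_univ _) (1 - 1 / N) (1 / N)
        (by rw [sub_nonneg, div_le_one hN0]; exact hN1.le) (by positivity) (by ring)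
      simp only [smul_eq_mul, Real.exp_zero] at this
      calc Real.exp (x / N) = Real.exp ((1 - 1 / N) * 0 + 1 / N * x) := by congr 1; ring
        _ ≤ _ := this
        _ = _ := by ring
    have hc2 : κ * Real.exp (x / N) ≤ κ - ρ + ρ * Real.exp x := by
      have := mul_le_mul_of_nonneg_left hconv (by positivity : 0 ≤ N * ρ)
      rw [hκN]
      refine this.trans_eq ?_
      field_simp
    have hP0 : 0 ≤ P := hP ▸ (Real.exp_pos _).le
    rw [← hPx, ← mul_assoc, ← Real.exp_add, ← add_sub_assoc, ← hP]
    nlinarith [mul_le_mul_of_nonneg_left hc2 hP0]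
  have h3 : g * b * Real.exp τ ≤ g ^ p * Real.exp τ / p + m * ((p - 1) / p) := by
    have hyoung := Real.young_inequality_of_nonneg hg (hb ▸ (Real.exp_pos _).le : 0 ≤ b)
      (Real.HolderConjugate.conjExponent hp)
    have hbm : b ^ (p.conjExponent) * Real.exp τ = m := by
      rw [hb, hm, ← Real.exp_mul, ← Real.exp_add, Real.conjExponent]
      congr 1
      rw [hκ, hρ]
      field_simp
      ring
    have := mul_le_mul_of_nonneg_right hyoung (Real.exp_pos τ).le
    refine this.trans_eq ?_
    rw [add_mul, div_mul_eq_mul_div, div_mul_eq_mul_div, hbm, Real.conjExponent]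
    congr 1
    field_simp
  have h4 : Real.exp (θ τ) * Real.exp x * Real.exp (u * (1 - N)) + Real.exp (θ τ) *
      (Real.exp (r * θ τ) * (r * Real.exp x) * (1 - N) * Real.exp (u * (1 - N - 1)))
      = m * (1 - κ * Real.exp (r * θ τ)) := by
    have e1 : Real.exp (θ τ) * Real.exp x * Real.exp (u * (1 - N - 1)) = m := by
      rw [hm, ← Real.exp_add, ← Real.exp_add, hx]
      ring_nf
    have e2 : Real.exp (u * (1 - N)) = Real.exp (u * (1 - N - 1)) * (1 + Real.exp (r * θ τ)) := by
      rw [hu, ← Real.exp_add]; ring_nf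
    have e3 : 1 + r * (1 - N) = - κ := by rw [hN, hκ]; field_simp; ring
    rw [e2, ← e1]
    linear_combination (Real.exp (θ τ) * Real.exp x * Real.exp (u * (1 - N - 1)) *
      Real.exp (r * θ τ)) * e3
  rw [h1, h4, hzm]
  have hk1 : (κ + 1) / p = 1 + ρ := by rw [hκ, hρ]; field_simp; ring
  have hk2 : (κ + 1) * ((p - 1) / p) - κ + ρ = 0 := by rw [hκ, hρ]; field_simp; ring
  have h3' := mul_le_mul_of_nonneg_left h3 (by positivity : 0 ≤ κ + 1)
  have h5 : (κ + 1) * (g ^ p * Real.exp τ / p + m * ((p - 1) / p)) =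
      (1 + ρ) * (g ^ p * Real.exp τ) + m * (κ - ρ) := by
    rw [← hk1]
    linear_combination m * hk2
  linarith

theorem integrable_of_le_exp {w : ℝ → ℝ} {a b C D : ℝ} (hc : Continuous w) (hw : ∀ s, 0 ≤ w s)
    (ha : 0 < a) (hb : 0 < b) (hC : ∀ s ≤ 0, w s ≤ C * Real.exp (a * s))
    (hD : ∀ s, 0 ≤ s → w s ≤ D * Real.exp (-b * s)) : Integrable w := by
  rw [← integrableOn_univ, ← Iic_union_Ioi (a := (0 : ℝ))]
  refine IntegrableOn.union ?_ ?_
  · refine ((integrableOn_exp_mul_Iic ha 0).const_mul C).mono' hc.aestronglyMeasurable ?_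
    filter_upwards [ae_restrict_mem measurableSet_Iic] with s hs
    rw [Real.norm_of_nonneg (hw s)]
    exact hC s hs
  · refine ((integrableOn_exp_mul_Ioi (neg_lt_zero.2 hb) 0).const_mul D).mono'
      hc.aestronglyMeasurable ?_
    filter_upwards [ae_restrict_mem measurableSet_Ioi] with s hs
    rw [Real.norm_of_nonneg (hw s)]
    exact hD s (le_of_lt hs)

/-- The density of the transported extremal, in logarithmic coordinates. -/
noncomputable def blissDensity (r N a s : ℝ) : ℝ :=
  Real.exp (a * s) * (1 + Real.exp (r * s)) ^ (-N)

theorem blissDensity_pos (r N a s : ℝ) : 0 < blissDensity r N a s := by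
  unfold blissDensity; positivity

theorem continuous_blissDensity (r N a : ℝ) : Continuous (blissDensity r N a) := by
  unfold blissDensity
  refine Continuous.mul (by fun_prop) (Continuous.rpow_const (by fun_prop) fun s => Or.inl ?_)
  positivity

theorem blissDensity_le {r N : ℝ} (hN : 0 < N) (a s : ℝ) :
    blissDensity r N a s ≤ Real.exp (a * s) := by
  unfold blissDensity
  refine mul_le_of_le_one_right (Real.exp_pos _).le ?_
  exact Real.rpow_le_one_of_one_le_of_nonpos (by linarith [Real.exp_pos (r * s)]) (by linarith)

theorem blissDensity_le' {r N : ℝ} (hN : 0 < N) (a s : ℝ) :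
    blissDensity r N a s ≤ Real.exp ((a - r * N) * s) := by
  unfold blissDensity
  have : (1 + Real.exp (r * s)) ^ (-N) ≤ (Real.exp (r * s)) ^ (-N) :=
    Real.rpow_le_rpow_of_nonpos (Real.exp_pos _) (by linarith) (by linarith)
  refine (mul_le_mul_of_nonneg_left this (Real.exp_pos _).le).trans_eq ?_
  rw [← Real.exp_mul, ← Real.exp_add]
  ring_nf

theorem integrable_blissDensity {r N a : ℝ} (hN : 0 < N) (ha : 0 < a) (haN : a < r * N) :
    Integrable (blissDensity r N a) :=
  integrable_of_le_exp (continuous_blissDensity _ _ _) (fun s => (blissDensity_pos _ _ _ s).le)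
    (C := 1) (D := 1) (b := r * N - a) ha (by linarith)
    (fun s _ => by rw [one_mul]; exact blissDensity_le hN a s)
    (fun s _ => by
      rw [one_mul]; refine (blissDensity_le' hN a s).trans_eq ?_; ring_nf)

theorem tendsto_blissDensity_atTop {r N a : ℝ} (hN : 0 < N) (haN : a < r * N) :
    Tendsto (blissDensity r N a) atTop (𝓝 0) := by
  refine squeeze_zero (fun s => (blissDensity_pos _ _ _ s).le) (blissDensity_le' hN a) ?_
  exact Real.tendsto_exp_atBot.comp
    (tendsto_id.const_mul_atTop_of_neg (by linarith : a - r * N < 0))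

theorem tendsto_blissDensity_atBot {r N a : ℝ} (hN : 0 < N) (ha : 0 < a) :
    Tendsto (blissDensity r N a) atBot (𝓝 0) := by
  refine squeeze_zero (fun s => (blissDensity_pos _ _ _ s).le) (blissDensity_le hN a) ?_
  exact Real.tendsto_exp_atBot.comp (tendsto_id.const_mul_atBot ha)

theorem integral_blissDensity_one {r N : ℝ} (hr : 0 < r) (hN : 1 < N) (hrN : r + 1 < r * N) :
    ∫ s, blissDensity r N 1 s = (r * N - r - 1) * ∫ s, blissDensity r N (r + 1) s := by
  have hN0 : 0 < N := by linarith
  have hd : ∀ s, HasDerivAt (blissDensity r (N - 1) 1)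
      (blissDensity r N 1 s - (r * N - r - 1) * blissDensity r N (r + 1) s) s := by
    intro s
    have hU : 1 + Real.exp (r * s) ≠ 0 := by positivity
    have := ((hasDerivAt_id s).const_mul 1).exp.mul
      ((((hasDerivAt_id s).const_mul r).exp.const_add 1).rpow_const (p := -(N - 1)) (Or.inl hU))
    refine this.congr_deriv ?_
    simp only [blissDensity, id]
    have e1 : (1 + Real.exp (r * s)) ^ (-(N - 1)) =
        (1 + Real.exp (r * s)) ^ (-N) * (1 + Real.exp (r * s)) := by
      rw [← Real.rpow_add_one hU]; ring_nf
    have e2 : -(N - 1) - 1 = -N := by ring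
    have e3 : Real.exp ((r + 1) * s) = Real.exp (r * s) * Real.exp (1 * s) := by
      rw [← Real.exp_add]; ring_nf
    rw [e1, e2, e3]
    ring
  have hi1 := integrable_blissDensity (r := r) (a := 1) hN0 one_pos (by linarith)
  have hi2 := integrable_blissDensity (r := r) (a := r + 1) hN0 (by linarith) hrN
  have := integral_of_hasDerivAt_of_tendsto hd (hi1.sub (hi2.const_mul _))
    (tendsto_blissDensity_atBot (by linarith) one_pos)
    (tendsto_blissDensity_atTop (by linarith) (by linarith))
  rw [integral_sub hi1 (hi2.const_mul _), integral_const_mul] at this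
  linarith

theorem integral_blissDensity_one_eq_betaFn {r N : ℝ} (hr : 0 < r) :
    ∫ s, blissDensity r N 1 s = 1 / r * betaFn (1 / r) (N - 1 / r) := by
  set φ : ℝ → ℝ := fun s => Real.exp (r * s) / (1 + Real.exp (r * s)) with hφ
  have hφ' : ∀ s, φ s = 1 - 1 / (1 + Real.exp (r * s)) := fun s => by
    simp only [hφ]; field_simp; ring
  have hd : ∀ s, HasDerivAt φ (r * Real.exp (r * s) / (1 + Real.exp (r * s)) ^ 2) s := by
    intro s
    have hE := ((hasDerivAt_id s).const_mul r).exp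
    have := hE.div (hE.const_add 1) (by positivity)
    refine this.congr_deriv ?_
    simp only [id]
    ring
  have himg : φ '' univ = Ioo 0 1 := by
    ext y
    simp only [image_univ, mem_range, mem_Ioo]
    constructor
    · rintro ⟨s, rfl⟩
      exact ⟨by positivity, by rw [hφ']; linarith [show 0 < 1 / (1 + Real.exp (r * s)) by positivity]⟩
    · rintro ⟨h0, h1⟩
      have h1' : 0 < 1 - y := by linarith
      refine ⟨Real.log (y / (1 - y)) / r, ?_⟩
      simp only [hφ]
      rw [mul_div_cancel₀ _ hr.ne', Real.exp_log (by positivity)]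
      field_simp
      ring
  have hinj : InjOn φ univ := by
    have : StrictMono φ := strictMono_of_hasDerivAt_pos hd (fun s => by positivity)
    exact this.injective.injOn
  have := integral_image_eq_integral_abs_deriv_smul MeasurableSet.univ
    (fun s _ => (hd s).hasDerivWithinAt) hinj
    (fun t => t ^ (1 / r - 1) * (1 - t) ^ (N - 1 / r - 1))
  rw [himg] at this
  rw [betaFn, this, Measure.restrict_univ, ← integral_const_mul]
  congr 1
  ext s
  obtain ⟨u, hu⟩ : ∃ u, 1 + Real.exp (r * s) = Real.exp u :=
    ⟨Real.log _, (Real.exp_log (by positivity)).symm⟩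
  have h1 : 1 - φ s = Real.exp (-u) := by
    rw [hφ', sub_sub_cancel, hu, Real.exp_neg, one_div]
  rw [abs_of_pos (by positivity), h1, hφ, blissDensity]
  simp only [smul_eq_mul, one_mul]
  rw [hu, ← Real.exp_sub, ← Real.exp_mul, ← Real.exp_mul, ← Real.exp_mul, ← Real.exp_nat_mul,
    mul_div_assoc, ← Real.exp_sub, ← mul_assoc, ← mul_assoc, ← mul_assoc, one_div_mul_cancel hr.ne', one_mul,
    ← Real.exp_add, ← Real.exp_add, ← Real.exp_add]
  congr 1
  push_cast
  field_simp
  ring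

theorem setIntegral_Iic_le_exp {w : ℝ → ℝ} {a C t : ℝ} (ha : 0 < a) (hi : Integrable w)
    (h : ∀ s ≤ t, w s ≤ C * Real.exp (a * s)) :
    ∫ s in Iic t, w s ≤ C * (Real.exp (a * t) / a) := by
  rw [← integral_exp_mul_Iic ha, ← integral_const_mul]
  exact setIntegral_mono_on hi.integrableOn ((integrableOn_exp_mul_Iic ha t).const_mul C)
    measurableSet_Iic h

theorem exp_le_setIntegral_Iic {w : ℝ → ℝ} {a C t : ℝ} (ha : 0 < a) (hi : Integrable w)
    (h : ∀ s ≤ t, C * Real.exp (a * s) ≤ w s) :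
    C * (Real.exp (a * t) / a) ≤ ∫ s in Iic t, w s := by
  rw [← integral_exp_mul_Iic ha, ← integral_const_mul]
  exact setIntegral_mono_on ((integrableOn_exp_mul_Iic ha t).const_mul C) hi.integrableOn
    measurableSet_Iic h

theorem integrable_hardy_power {p r C : ℝ} {g : ℝ → ℝ} (hp : 1 < p) (hr : 0 < r)
    (hgc : Continuous g) (hg : ∀ s, 0 < g s) (hgC : ∀ s, g s ≤ C)
    (hgi : Integrable fun s => g s * Real.exp s) :
    Continuous (fun t => (∫ s in Iic t, g s * Real.exp s) ^ (p * (r + 1)) *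
        Real.exp (-((p - 1) * (r + 1)) * t)) ∧
    Integrable (fun t => (∫ s in Iic t, g s * Real.exp s) ^ (p * (r + 1)) *
        Real.exp (-((p - 1) * (r + 1)) * t)) := by
  have hp1 : 0 < p - 1 := by linarith
  have hgec : Continuous fun s => g s * Real.exp s := hgc.mul Real.continuous_exp
  have hge : ∀ s, 0 < g s * Real.exp s := fun s => mul_pos (hg s) (Real.exp_pos s)
  have hF0 := setIntegral_Iic_pos hgec hgi hge
  have hC : 0 < C := (hg 0).trans_le (hgC 0)
  have hc : Continuous (fun t => (∫ s in Iic t, g s * Real.exp s) ^ (p * (r + 1)) *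
        Real.exp (-((p - 1) * (r + 1)) * t)) := by
    refine Continuous.mul (Continuous.rpow_const ?_ fun t => Or.inl (hF0 t).ne') (by fun_prop)
    exact continuous_iff_continuousAt.2 fun x =>
      (hasDerivAt_setIntegral_Iic hgec hgi x).continuousAt
  refine ⟨hc, integrable_of_le_exp (a := r + 1) (b := (p - 1) * (r + 1)) (C := C ^ (p * (r + 1)))
    (D := (∫ s, g s * Real.exp s) ^ (p * (r + 1))) hc (fun t => ?_) (by linarith)
    (by positivity) (fun t _ => ?_) (fun t _ => ?_)⟩
  · have := hF0 t
    positivity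
  · have h1 : ∫ s in Iic t, g s * Real.exp s ≤ C * Real.exp t := by
      have := setIntegral_Iic_le_exp (t := t) (C := C) one_pos hgi (fun s _ => by
        rw [one_mul]; exact mul_le_mul_of_nonneg_right (hgC s) (Real.exp_pos s).le)
      simpa using this
    have h2 := Real.rpow_le_rpow (hF0 t).le h1 (by positivity : 0 ≤ p * (r + 1))
    refine (mul_le_mul_of_nonneg_right h2 (Real.exp_pos _).le).trans_eq ?_
    rw [Real.mul_rpow hC.le (Real.exp_pos _).le, ← Real.exp_mul, mul_assoc, ← Real.exp_add]
    ring_nf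
  · exact mul_le_mul_of_nonneg_right (Real.rpow_le_rpow (hF0 t).le
      (setIntegral_Iic_lt hgec hgi hge t).le (by positivity)) (Real.exp_pos _).le

/-- Bliss' inequality for regular densities, normalised so that the left-hand side agrees with that
of the extremal. -/
theorem bliss_of_integral_eq {p r C ε : ℝ} {g : ℝ → ℝ} (hp : 1 < p) (hr : 0 < r)
    (hgc : Continuous g) (hg : ∀ s, 0 < g s) (hgC : ∀ s, g s ≤ C) (hε : 0 < ε)
    (hgε : ∀ s ≤ 0, ε ≤ g s) (hgi : Integrable fun s => g s * Real.exp s)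
    (hgp : Integrable fun s => g s ^ p * Real.exp s)
    (hJ : ∫ t, (∫ s in Iic t, g s * Real.exp s) ^ (p * (r + 1)) *
        Real.exp (-((p - 1) * (r + 1)) * t) =
      ∫ s, blissDensity r (p * (r + 1) / r) (r + 1) s) :
    (p - 1) * (r + 1) * ∫ s, blissDensity r (p * (r + 1) / r) (r + 1) s ≤
      ∫ s, g s ^ p * Real.exp s := by
  have hp0 : 0 < p := by linarith
  have hp1 : 0 < p - 1 := by linarith
  have hgec : Continuous fun s => g s * Real.exp s := hgc.mul Real.continuous_exp
  have hge : ∀ s, 0 < g s * Real.exp s := fun s => mul_pos (hg s) (Real.exp_pos s)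
  have hF0 := setIntegral_Iic_pos hgec hgi hge
  have hFd := hasDerivAt_setIntegral_Iic hgec hgi
  have hC : 0 < C := (hg 0).trans_le (hgC 0)
  obtain ⟨hwc, hwi⟩ := integrable_hardy_power hp hr hgc hg hgC hgi
  have hFC : ∀ t, ∫ s in Iic t, g s * Real.exp s ≤ C * Real.exp t := fun t => by
    have := setIntegral_Iic_le_exp (t := t) (C := C) one_pos hgi (fun s _ => by
      rw [one_mul]; exact mul_le_mul_of_nonneg_right (hgC s) (Real.exp_pos s).le)
    simpa using this
  have hFε : ∀ t ≤ 0, ε * Real.exp t ≤ ∫ s in Iic t, g s * Real.exp s := fun t ht => by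
    have := exp_le_setIntegral_Iic (t := t) (C := ε) one_pos hgi (fun s hs => by
      rw [one_mul]; exact mul_le_mul_of_nonneg_right (hgε s (hs.trans ht)) (Real.exp_pos s).le)
    simpa using this
  set F := fun t => ∫ s in Iic t, g s * Real.exp s with hF
  set ρ := r * (p - 1) / p with hρ
  set κ := (p - 1) * (r + 1) with hκ
  set N := p * (r + 1) / r with hN
  have hρ0 : 0 < ρ := by positivity
  have hκ0 : 0 < κ := by positivity
  have hN0 : 0 < N := by positivity
  have hN1 : 1 < N := by rw [hN, lt_div_iff₀ hr]; nlinarith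
  have hrN : r * N = p * (r + 1) := by rw [hN]; field_simp
  have hw0 : ∀ t, 0 < F t ^ (p * (r + 1)) * Real.exp (-κ * t) := fun t => by
    have := hF0 t
    positivity
  have hvc := continuous_blissDensity r N (r + 1)
  have hvi : Integrable (blissDensity r N (r + 1)) :=
    integrable_blissDensity hN0 (by linarith) (by rw [hrN]; nlinarith)
  have hv0 := blissDensity_pos r N (r + 1)
  obtain ⟨θ, hθ, hθd⟩ := exists_monotone_transport hwc hwi hw0 hvc hvi hv0 hJ
  have hzd := hasDerivAt_setIntegral_Iic hwc hwi
  set z := fun t => ∫ s in Iic t, F s ^ (p * (r + 1)) * Real.exp (-κ * s) with hz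
  have hθz : ∀ t, ∫ s in Iic (θ t), blissDensity r N (r + 1) s = z t := hθ
  have hz0 : Tendsto z atBot (𝓝 0) := tendsto_setIntegral_Iic_atBot hwi
  have hcal := fun t => bliss_calibration hp hr (hg t).le (hF0 t) (hFd t) (hzd t) (hθd t)
  choose d hd hLd using hcal
  set L := fun t => F t ^ (κ + 1) * Real.exp ((ρ - κ) * t - ρ * θ t)
        + ρ * (Real.exp (θ t) * (1 + Real.exp (r * θ t)) ^ (1 - N))
        + κ * (1 + ρ) * z t with hL
  have hLc : Continuous L := continuous_iff_continuousAt.2 fun t => (hLd t).continuousAt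
  have hstep : ∀ a b, a ≤ b → L b - L a ≤ (1 + ρ) * ∫ s, g s ^ p * Real.exp s := by
    intro a b hab
    have h1 := intervalIntegral.sub_le_integral_of_hasDeriv_right_of_le hab hLc.continuousOn
      (fun x _ => (hLd x).hasDerivWithinAt) ((hgp.const_mul (1 + ρ)).integrableOn) (fun x _ => hd x)
    refine h1.trans ?_
    rw [intervalIntegral.integral_of_le hab, ← integral_const_mul]
    refine setIntegral_le_integral (hgp.const_mul _) (Eventually.of_forall fun s => ?_)
    have := (hg s).le
    positivity
  have hθlim : Tendsto θ atBot atBot := by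
    refine tendsto_atBot.2 fun A => ?_
    filter_upwards [hz0.eventually_lt_const (setIntegral_Iic_pos hvc hvi hv0 A)] with t ht
    rw [← hθz] at ht
    exact ((strictMono_setIntegral_Iic hvc hvi hv0).lt_iff_lt.1 ht).le
  obtain ⟨c, hc⟩ : ∃ c, ε ^ (p * (r + 1)) = Real.exp ((r + 1) * c) :=
    ⟨Real.log (ε ^ (p * (r + 1))) / (r + 1), by
      rw [mul_div_cancel₀ _ (by linarith), Real.exp_log (by positivity)]⟩
  have hθle : ∀ t ≤ 0, t + c ≤ θ t := by
    intro t ht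
    have h1 : Real.exp ((r + 1) * c) * (Real.exp ((r + 1) * t) / (r + 1)) ≤ z t := by
      refine exp_le_setIntegral_Iic (by linarith) hwi fun s hs => ?_
      rw [← hc]
      refine le_trans (le_of_eq ?_) (mul_le_mul_of_nonneg_right
        (Real.rpow_le_rpow (by positivity) (hFε s (hs.trans ht)) (by positivity))
        (Real.exp_pos _).le)
      rw [Real.mul_rpow hε.le (Real.exp_pos _).le, ← Real.exp_mul, mul_assoc, ← Real.exp_add, hκ]
      ring_nf
    have h2 : z t ≤ 1 * (Real.exp ((r + 1) * θ t) / (r + 1)) := by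
      rw [← hθz]
      exact setIntegral_Iic_le_exp (by linarith) hvi
        fun s _ => (blissDensity_le hN0 _ s).trans_eq (one_mul _).symm
    have h3 := h1.trans h2
    rw [one_mul, ← mul_div_assoc, div_le_div_iff_of_pos_right (by linarith), ← Real.exp_add,
      Real.exp_le_exp, ← mul_add] at h3
    linarith [le_of_mul_le_mul_left h3 (by linarith)]
  have hLlim : Tendsto L atBot (𝓝 0) := by
    have h1 : Tendsto (fun t => F t ^ (κ + 1) * Real.exp ((ρ - κ) * t - ρ * θ t)) atBot (𝓝 0) := by
      refine squeeze_zero' (g := fun t => C ^ (κ + 1) * Real.exp (-ρ * c) * Real.exp t)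
        (Eventually.of_forall fun t => ?_) ?_ ?_
      · have := hF0 t
        positivity
      · filter_upwards [eventually_le_atBot 0] with t ht
        have h2 : Real.exp ((ρ - κ) * t - ρ * θ t) ≤ Real.exp ((ρ - κ) * t - ρ * (t + c)) := by
          refine Real.exp_le_exp.2 ?_
          nlinarith [hθle t ht]
        refine (mul_le_mul (Real.rpow_le_rpow (hF0 t).le (hFC t) (by positivity)) h2
          (Real.exp_pos _).le (by positivity)).trans_eq ?_
        rw [Real.mul_rpow hC.le (Real.exp_pos _).le, ← Real.exp_mul, mul_assoc, mul_assoc,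
          ← Real.exp_add, ← Real.exp_add]
        ring_nf
      · simpa using Real.tendsto_exp_atBot.const_mul (C ^ (κ + 1) * Real.exp (-ρ * c))
    have h2 : Tendsto (fun t => Real.exp (θ t) * (1 + Real.exp (r * θ t)) ^ (1 - N)) atBot (𝓝 0) := by
      refine squeeze_zero (fun t => by positivity) (fun t => ?_)
        (Real.tendsto_exp_atBot.comp hθlim)
      refine mul_le_of_le_one_right (Real.exp_pos _).le ?_
      exact Real.rpow_le_one_of_one_le_of_nonpos (by linarith [Real.exp_pos (r * θ t)])
        (by linarith)
    have := (h1.add (h2.const_mul ρ)).add (hz0.const_mul (κ * (1 + ρ)))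
    simpa using this
  have hb : ∀ b, κ * z b ≤ ∫ s, g s ^ p * Real.exp s := by
    intro b
    have h1 : L b - 0 ≤ (1 + ρ) * ∫ s, g s ^ p * Real.exp s :=
      le_of_tendsto (hLlim.const_sub _) (by
        filter_upwards [eventually_le_atBot b] with a ha using hstep a b ha)
    have h2 : κ * (1 + ρ) * z b ≤ L b := by
      have := hF0 b
      rw [hL]
      refine le_add_of_nonneg_left ?_
      positivity
    refine le_of_mul_le_mul_left ?_ (by positivity : 0 < 1 + ρ)
    linarith
  have hzlim : Tendsto z atTop (𝓝 _) := tendsto_setIntegral_Iic_atTop hwi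
  rw [← hJ]
  exact le_of_tendsto' (hzlim.const_mul κ) hb

theorem bliss_of_regular {p r C ε : ℝ} {g : ℝ → ℝ} (hp : 1 < p) (hr : 0 < r)
    (hgc : Continuous g) (hg : ∀ s, 0 < g s) (hgC : ∀ s, g s ≤ C) (hε : 0 < ε)
    (hgε : ∀ s ≤ 0, ε ≤ g s) (hgi : Integrable fun s => g s * Real.exp s)
    (hgp : Integrable fun s => g s ^ p * Real.exp s) :
    ∫ t, (∫ s in Iic t, g s * Real.exp s) ^ (p * (r + 1)) *
        Real.exp (-((p - 1) * (r + 1)) * t) ≤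
      1 / ((p - 1) * (r + 1)) * (∫ s, blissDensity r (p * (r + 1) / r) 1 s) ^ (-r) *
        (∫ s, g s ^ p * Real.exp s) ^ (r + 1) := by
  have hp0 : 0 < p := by linarith
  have hp1 : 0 < p - 1 := by linarith
  have hr1 : 0 < r + 1 := by linarith
  have hN1 : 1 < p * (r + 1) / r := by rw [lt_div_iff₀ hr]; nlinarith
  have hrN : r * (p * (r + 1) / r) = p * (r + 1) := by field_simp
  have hge : ∀ s, 0 < g s * Real.exp s := fun s => mul_pos (hg s) (Real.exp_pos s)
  have hF0 : ∀ t, 0 < ∫ s in Iic t, g s * Real.exp s :=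
    setIntegral_Iic_pos (hgc.mul Real.continuous_exp) hgi hge
  obtain ⟨hwc, hwi⟩ := integrable_hardy_power hp hr hgc hg hgC hgi
  have hK := integral_blissDensity_one hr hN1 (by rw [hrN]; nlinarith)
  have hV : 0 < ∫ s, blissDensity r (p * (r + 1) / r) (r + 1) s :=
    (setIntegral_Iic_pos (continuous_blissDensity _ _ _) (integrable_blissDensity (by linarith)
      (by linarith) (by rw [hrN]; nlinarith)) (blissDensity_pos _ _ _) 0).trans
      (setIntegral_Iic_lt (continuous_blissDensity _ _ _) (integrable_blissDensity (by linarith)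
      (by linarith) (by rw [hrN]; nlinarith)) (blissDensity_pos _ _ _) 0)
  have hκ : r * (p * (r + 1) / r) - r - 1 = (p - 1) * (r + 1) := by rw [hrN]; ring
  rw [hκ] at hK
  have hw0 : ∀ t, 0 < (∫ s in Iic t, g s * Real.exp s) ^ (p * (r + 1)) *
        Real.exp (-((p - 1) * (r + 1)) * t) := fun t => by
    have := hF0 t
    positivity
  have hJ0 := (setIntegral_Iic_pos hwc hwi hw0 0).trans (setIntegral_Iic_lt hwc hwi hw0 0)
  set J := ∫ t, (∫ s in Iic t, g s * Real.exp s) ^ (p * (r + 1)) *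
        Real.exp (-((p - 1) * (r + 1)) * t) with hJ
  set V := ∫ s, blissDensity r (p * (r + 1) / r) (r + 1) s with hVd
  obtain ⟨c, hc⟩ : ∃ c, c = (V / J) ^ (1 / (p * (r + 1))) := ⟨_, rfl⟩
  have hc0 : 0 < c := by rw [hc]; positivity
  have hcq : c ^ (p * (r + 1)) = V / J := by
    rw [hc, ← Real.rpow_mul (by positivity), one_div_mul_cancel (by positivity), Real.rpow_one]
  have hnorm := bliss_of_integral_eq (g := fun s => c * g s) (C := c * C) (ε := c * ε) hp hr
    (hgc.const_mul c) (fun s => mul_pos hc0 (hg s))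
    (fun s => mul_le_mul_of_nonneg_left (hgC s) hc0.le) (by positivity)
    (fun s hs => mul_le_mul_of_nonneg_left (hgε s hs) hc0.le)
    (by simpa only [mul_assoc] using hgi.const_mul c)
    (by
      have := hgp.const_mul (c ^ p)
      refine this.congr (Eventually.of_forall fun s => ?_)
      simp only
      rw [Real.mul_rpow hc0.le (hg s).le, mul_assoc])
    (by
      have : ∀ t, (∫ s in Iic t, c * g s * Real.exp s) ^ (p * (r + 1)) *
        Real.exp (-((p - 1) * (r + 1)) * t) = (V / J) *
          ((∫ s in Iic t, g s * Real.exp s) ^ (p * (r + 1)) *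
        Real.exp (-((p - 1) * (r + 1)) * t)) := fun t => by
        simp only [mul_assoc c]
        rw [integral_const_mul, Real.mul_rpow hc0.le (hF0 t).le, hcq, mul_assoc]
      simp only [this]
      rw [integral_const_mul, ← hJ, div_mul_cancel₀ _ hJ0.ne'])
  have hI : ∫ s, (c * g s) ^ p * Real.exp s = c ^ p * ∫ s, g s ^ p * Real.exp s := by
    rw [← integral_const_mul]
    congr 1
    ext s
    rw [Real.mul_rpow hc0.le (hg s).le, mul_assoc]
  rw [hI, ← hVd, ← hK] at hnorm
  set K := ∫ s, blissDensity r (p * (r + 1) / r) 1 s with hKd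
  have hK0 : 0 < K := by rw [hK]; positivity
  set I := ∫ s, g s ^ p * Real.exp s with hId
  have hI0 : 0 ≤ I := integral_nonneg fun s => by have := (hg s).le; positivity
  have h1 := Real.rpow_le_rpow hK0.le hnorm hr1.le
  rw [Real.mul_rpow (by positivity) hI0, ← Real.rpow_mul hc0.le, hcq] at h1
  have h2 : K ^ (r + 1) * J ≤ V * I ^ (r + 1) := by
    have := mul_le_mul_of_nonneg_right h1 hJ0.le
    refine this.trans_eq ?_
    field_simp
  have hV' : V = 1 / ((p - 1) * (r + 1)) * K := by rw [hK]; field_simp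
  have h3 : J ≤ V * I ^ (r + 1) / K ^ (r + 1) := by
    rw [le_div_iff₀ (by positivity), mul_comm]; exact h2
  refine h3.trans_eq ?_
  rw [hV', Real.rpow_add_one hK0.ne' r, Real.rpow_neg hK0.le]
  field_simp

/-- Lebesgue measure on `(0, ∞)` in logarithmic coordinates. -/
noncomputable def expMeasure : Measure ℝ :=
  volume.withDensity fun s => ENNReal.ofReal (Real.exp s)

instance : IsLocallyFiniteMeasure expMeasure :=
  IsLocallyFiniteMeasure.withDensity_ofReal Real.continuous_exp

theorem lintegral_expMeasure {g : ℝ → ℝ≥0∞} (hg : Measurable g) :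
    ∫⁻ s, g s ∂expMeasure = ∫⁻ s, g s * ENNReal.ofReal (Real.exp s) := by
  rw [expMeasure, lintegral_withDensity_eq_lintegral_mul _ (by fun_prop) hg]
  simp only [Pi.mul_apply, mul_comm]

theorem setLIntegral_expMeasure {g : ℝ → ℝ≥0∞} (hg : Measurable g) {A : Set ℝ}
    (hA : MeasurableSet A) :
    ∫⁻ s in A, g s ∂expMeasure = ∫⁻ s in A, g s * ENNReal.ofReal (Real.exp s) := by
  rw [expMeasure, setLIntegral_withDensity_eq_setLIntegral_mul _ (by fun_prop) hg hA]
  simp only [Pi.mul_apply, mul_comm]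

theorem bliss_lintegral_of_regular {p r C ε : ℝ} {g : ℝ → ℝ} (hp : 1 < p) (hr : 0 < r)
    (hgc : Continuous g) (hg : ∀ s, 0 < g s) (hgC : ∀ s, g s ≤ C) (hε : 0 < ε)
    (hgε : ∀ s ≤ 0, ε ≤ g s) (hgi : Integrable fun s => g s * Real.exp s) :
    ∫⁻ t, (∫⁻ s in Iic t, ENNReal.ofReal (g s) ∂expMeasure) ^ (p * (r + 1)) *
        ENNReal.ofReal (Real.exp (-((p - 1) * (r + 1)) * t)) ≤
      ENNReal.ofReal (1 / ((p - 1) * (r + 1)) *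
        (∫ s, blissDensity r (p * (r + 1) / r) 1 s) ^ (-r)) *
        (∫⁻ s, ENNReal.ofReal (g s) ^ p ∂expMeasure) ^ (r + 1) := by
  have hp0 : 0 < p := by linarith
  have hC : 0 < C := (hg 0).trans_le (hgC 0)
  have hgp : Integrable fun s => g s ^ p * Real.exp s := by
    refine (hgi.const_mul (C ^ (p - 1))).mono' ?_ (Eventually.of_forall fun s => ?_)
    · exact ((hgc.rpow_const fun s => Or.inl (hg s).ne').mul
        Real.continuous_exp).aestronglyMeasurable
    · have h1 : g s ^ p = g s ^ (p - 1) * g s := by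
        rw [← Real.rpow_add_one (hg s).ne', sub_add_cancel]
      have h2 := Real.rpow_le_rpow (hg s).le (hgC s) (by linarith : 0 ≤ p - 1)
      have h3 := (hg s)
      rw [Real.norm_of_nonneg (by positivity), h1, mul_assoc]
      exact mul_le_mul_of_nonneg_right h2 (by positivity)
  have hge : ∀ s, 0 < g s * Real.exp s := fun s => mul_pos (hg s) (Real.exp_pos s)
  have hF0 : ∀ t, 0 < ∫ s in Iic t, g s * Real.exp s :=
    setIntegral_Iic_pos (hgc.mul Real.continuous_exp) hgi hge
  obtain ⟨hwc, hwi⟩ := integrable_hardy_power hp hr hgc hg hgC hgi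
  have hF : ∀ t, ∫⁻ s in Iic t, ENNReal.ofReal (g s) ∂expMeasure =
      ENNReal.ofReal (∫ s in Iic t, g s * Real.exp s) := fun t => by
    rw [setLIntegral_expMeasure hgc.measurable.ennreal_ofReal measurableSet_Iic,
      ofReal_integral_eq_lintegral_ofReal hgi.integrableOn
        (Eventually.of_forall fun s => (hge s).le)]
    simp only [ENNReal.ofReal_mul (hg _).le]
  have hI : ∫⁻ s, ENNReal.ofReal (g s) ^ p ∂expMeasure =
      ENNReal.ofReal (∫ s, g s ^ p * Real.exp s) := by
    rw [lintegral_expMeasure (hgc.measurable.ennreal_ofReal.pow_const p),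
      ofReal_integral_eq_lintegral_ofReal hgp
        (Eventually.of_forall fun s => by have := (hg s).le; positivity)]
    congr 1
    ext s
    rw [ENNReal.ofReal_rpow_of_nonneg (hg s).le hp0.le,
      ENNReal.ofReal_mul (Real.rpow_nonneg (hg s).le _)]
  have hJ : ∀ t, ENNReal.ofReal (∫ s in Iic t, g s * Real.exp s) ^ (p * (r + 1)) *
        ENNReal.ofReal (Real.exp (-((p - 1) * (r + 1)) * t)) =
      ENNReal.ofReal ((∫ s in Iic t, g s * Real.exp s) ^ (p * (r + 1)) *
        Real.exp (-((p - 1) * (r + 1)) * t)) := fun t => by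
    rw [ENNReal.ofReal_rpow_of_nonneg (hF0 t).le (by positivity),
      ENNReal.ofReal_mul (Real.rpow_nonneg (hF0 t).le _)]
  have hI0 : 0 ≤ ∫ s, g s ^ p * Real.exp s :=
    integral_nonneg fun s => by have := (hg s).le; positivity
  have hK0 : 0 ≤ ∫ s, blissDensity r (p * (r + 1) / r) 1 s :=
    integral_nonneg fun s => (blissDensity_pos _ _ _ s).le
  have hp1 : 0 < p - 1 := by linarith
  simp only [hF, hI, hJ]
  rw [← ofReal_integral_eq_lintegral_ofReal hwi (Eventually.of_forall fun t => by
      have := (hF0 t).le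
      positivity),
    ENNReal.ofReal_rpow_of_nonneg hI0 (by linarith), ← ENNReal.ofReal_mul (by positivity)]
  exact ENNReal.ofReal_le_ofReal
    (bliss_of_regular hp hr hgc hg hgC hε hgε hgi hgp)

/-- **Bliss' inequality** with its sharp constant, in logarithmic coordinates. -/
theorem bliss_lintegral {p r : ℝ} {g : ℝ → ℝ≥0∞} (hp : 1 < p) (hr : 0 < r) (hg : Measurable g)
    (hgI : ∫⁻ s, g s ^ p ∂expMeasure ≠ ∞) :
    ∫⁻ t, (∫⁻ s in Iic t, g s ∂expMeasure) ^ (p * (r + 1)) *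
        ENNReal.ofReal (Real.exp (-((p - 1) * (r + 1)) * t)) ≤
      ENNReal.ofReal (1 / ((p - 1) * (r + 1)) *
        (∫ s, blissDensity r (p * (r + 1) / r) 1 s) ^ (-r)) *
        (∫⁻ s, g s ^ p ∂expMeasure) ^ (r + 1) := by
  have hp0 : 0 < p := by linarith
  have hr1 : 0 < r + 1 := by linarith
  have hP0 : ENNReal.ofReal p ≠ 0 := by simpa using hp0
  have hP1 : 1 ≤ ENNReal.ofReal p := by simpa using hp.le
  have hPt : ENNReal.ofReal p ≠ ∞ := ENNReal.ofReal_ne_top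
  have hnorm : ∀ f : ℝ → ℝ, (∀ s, 0 ≤ f s) → eLpNorm f (ENNReal.ofReal p) expMeasure ^ p =
      ∫⁻ s, ENNReal.ofReal (f s) ^ p ∂expMeasure := fun f hf => by
    rw [eLpNorm_eq_lintegral_rpow_enorm_toReal hP0 hPt, ENNReal.toReal_ofReal hp0.le,
      ← ENNReal.rpow_mul, one_div_mul_cancel hp0.ne', ENNReal.rpow_one]
    simp only [Real.enorm_of_nonneg (hf _)]
  have hfin : ∀ᵐ s ∂expMeasure, g s < ∞ := by
    filter_upwards [ae_lt_top (hg.pow_const p) hgI] with s hs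
    exact lt_top_iff_ne_top.2 fun h => by simp [h, hp0] at hs
  set f : ℝ → ℝ := fun s => (g s).toReal with hf
  have hfm : Measurable f := hg.ennreal_toReal
  have hf0 : ∀ s, 0 ≤ f s := fun s => ENNReal.toReal_nonneg
  have hfg : ∀ᵐ s ∂expMeasure, ENNReal.ofReal (f s) = g s := by
    filter_upwards [hfin] with s hs using ENNReal.ofReal_toReal hs.ne
  have hfn : eLpNorm f (ENNReal.ofReal p) expMeasure ^ p = ∫⁻ s, g s ^ p ∂expMeasure := by
    rw [hnorm f hf0]
    refine lintegral_congr_ae ?_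
    filter_upwards [hfg] with s hs
    rw [hs]
  have hfL : MemLp f (ENNReal.ofReal p) expMeasure := by
    refine ⟨hfm.aestronglyMeasurable, lt_top_iff_ne_top.2 fun h => hgI ?_⟩
    rw [← hfn, h, ENNReal.top_rpow_of_pos hp0]
  -- the integrable perturbation keeping approximants positive
  set h0 : ℝ → ℝ := fun s => Real.exp (-|s| - s) with hh0
  have hh0c : Continuous h0 := by simp only [hh0]; fun_prop
  have hh0pos : ∀ s, 0 < h0 s := fun s => Real.exp_pos _
  have hh0le : ∀ s, h0 s ≤ 1 := fun s => Real.exp_le_one_iff.2 (by linarith [neg_abs_le s])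
  have hh0eq : ∀ s ≤ 0, h0 s = 1 := fun s hs => by simp [hh0, abs_of_nonpos hs]
  have hh0i : Integrable fun s => h0 s * Real.exp s := by
    refine integrable_of_le_exp (a := 1) (b := 1) (C := 1) (D := 1)
      (hh0c.mul Real.continuous_exp) (fun s => by positivity) one_pos one_pos
      (fun s hs => ?_) (fun s hs => ?_)
    · rw [hh0eq s hs, one_mul, one_mul, one_mul]
    · simp only [hh0]
      rw [abs_of_nonneg hs, ← Real.exp_add]
      ring_nf
      rfl
  have hh0L : MemLp h0 (ENNReal.ofReal p) expMeasure := by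
    refine ⟨hh0c.aestronglyMeasurable, lt_top_iff_ne_top.2 fun h => ?_⟩
    have h1 : ∫⁻ s, ENNReal.ofReal (h0 s) ^ p ∂expMeasure = ∞ := by
      rw [← hnorm h0 fun s => (hh0pos s).le, h, ENNReal.top_rpow_of_pos hp0]
    have h2 : ∫⁻ s, ENNReal.ofReal (h0 s) ^ p ∂expMeasure ≤
        ∫⁻ s, ENNReal.ofReal (h0 s * Real.exp s) := by
      rw [lintegral_expMeasure (hh0c.measurable.ennreal_ofReal.pow_const p)]
      refine lintegral_mono fun s => ?_
      rw [ENNReal.ofReal_mul (hh0pos s).le]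
      gcongr
      refine (ENNReal.rpow_le_rpow_of_exponent_ge ?_ hp.le).trans_eq (ENNReal.rpow_one _)
      simpa using hh0le s
    rw [h1, top_le_iff] at h2
    exact hh0i.lintegral_lt_top.ne h2
  have happrox : ∀ n : ℕ, ∃ φ : ℝ → ℝ, HasCompactSupport φ ∧
      eLpNorm (f - φ) (ENNReal.ofReal p) expMeasure ≤ ENNReal.ofReal (1 / (n + 1)) ∧
      Continuous φ ∧ MemLp φ (ENNReal.ofReal p) expMeasure := fun n =>
    hfL.exists_hasCompactSupport_eLpNorm_sub_le hPt (by
      simp only [ne_eq, ENNReal.ofReal_eq_zero, not_le]; positivity)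
  choose φ hφs hφn hφc hφL using happrox
  have hn0 : ∀ n : ℕ, (0 : ℝ) < 1 / (n + 1) := fun n => by positivity
  set h : ℕ → ℝ → ℝ := fun n s => |φ n s| + 1 / (n + 1) * h0 s with hh
  have hhc : ∀ n, Continuous (h n) := fun n => by
    have := hφc n
    simp only [hh]
    fun_prop
  have hhpos : ∀ n s, 0 < h n s := fun n s => by
    have := hh0pos s
    have := hn0 n
    simp only [hh]
    positivity
  have hdist : ∀ n, eLpNorm (h n - f) (ENNReal.ofReal p) expMeasure ≤
      ENNReal.ofReal (1 / (n + 1)) * (1 + eLpNorm h0 (ENNReal.ofReal p) expMeasure) := fun n => by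
    have h1 : eLpNorm (h n - f) (ENNReal.ofReal p) expMeasure ≤
        eLpNorm ((fun s => ‖(f - φ n) s‖) + (1 / (n + 1) : ℝ) • h0) (ENNReal.ofReal p)
          expMeasure := by
      refine eLpNorm_mono_real fun s => ?_
      simp only [hh, Pi.sub_apply, Pi.add_apply, Pi.smul_apply, smul_eq_mul, Real.norm_eq_abs]
      have e1 : |φ n s| + 1 / (n + 1) * h0 s - f s = (|φ n s| - |f s|) + 1 / (n + 1) * h0 s := by
        rw [abs_of_nonneg (hf0 s)]; ring
      rw [e1]
      refine (abs_add_le _ _).trans (add_le_add ?_ (abs_of_pos (mul_pos (hn0 n) (hh0pos s))).le)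
      rw [abs_sub_comm (f s)]
      exact abs_abs_sub_abs_le _ _
    refine h1.trans ((eLpNorm_add_le (hfL.sub (hφL n)).1.norm
      (hh0L.const_smul _).1 hP1).trans ?_)
    rw [eLpNorm_norm, eLpNorm_const_smul, mul_add, mul_one, Real.enorm_of_nonneg (hn0 n).le]
    exact add_le_add (hφn n) le_rfl
  have hδ : Tendsto (fun n : ℕ => ENNReal.ofReal (1 / (n + 1)) *
      (1 + eLpNorm h0 (ENNReal.ofReal p) expMeasure)) atTop (𝓝 0) := by
    have : Tendsto (fun n : ℕ => ENNReal.ofReal (1 / (n + 1))) atTop (𝓝 0) := by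
      simpa using ENNReal.tendsto_ofReal (tendsto_one_div_add_atTop_nhds_zero_nat (𝕜 := ℝ))
    simpa using ENNReal.Tendsto.mul_const this (b := 1 + eLpNorm h0 (ENNReal.ofReal p) expMeasure)
      (Or.inr (ENNReal.add_ne_top.2 ⟨ENNReal.one_ne_top, hh0L.2.ne⟩))
  have hlim : Tendsto (fun n => eLpNorm (h n - f) (ENNReal.ofReal p) expMeasure) atTop (𝓝 0) :=
    tendsto_of_tendsto_of_tendsto_of_le_of_le tendsto_const_nhds hδ (fun _ => zero_le) hdist
  obtain ⟨ns, hns, hae⟩ := (tendstoInMeasure_of_tendsto_eLpNorm hP0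
    (fun n => (hhc n).aestronglyMeasurable) hfm.aestronglyMeasurable hlim).exists_seq_tendsto_ae
  have hnle : ∀ n, eLpNorm (h n) (ENNReal.ofReal p) expMeasure ≤
      eLpNorm f (ENNReal.ofReal p) expMeasure +
        eLpNorm (h n - f) (ENNReal.ofReal p) expMeasure := fun n => by
    have := eLpNorm_add_le (μ := expMeasure) hfm.aestronglyMeasurable
      ((hhc n).aestronglyMeasurable.sub hfm.aestronglyMeasurable) hP1
    rwa [add_sub_cancel] at this
  have hnlim : Tendsto (fun n => eLpNorm f (ENNReal.ofReal p) expMeasure +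
        eLpNorm (h n - f) (ENNReal.ofReal p) expMeasure) atTop
      (𝓝 (eLpNorm f (ENNReal.ofReal p) expMeasure)) := by
    simpa using hlim.const_add (eLpNorm f (ENNReal.ofReal p) expMeasure)
  have hreg : ∀ n, ∫⁻ t, (∫⁻ s in Iic t, ENNReal.ofReal (h n s) ∂expMeasure) ^ (p * (r + 1)) *
        ENNReal.ofReal (Real.exp (-((p - 1) * (r + 1)) * t)) ≤
      ENNReal.ofReal (1 / ((p - 1) * (r + 1)) *
        (∫ s, blissDensity r (p * (r + 1) / r) 1 s) ^ (-r)) *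
        (eLpNorm (h n) (ENNReal.ofReal p) expMeasure ^ p) ^ (r + 1) := fun n => by
    rw [hnorm (h n) fun s => (hhpos n s).le]
    obtain ⟨C, hC⟩ := (hφc n).bounded_above_of_compact_support (hφs n)
    refine bliss_lintegral_of_regular (C := C + 1 / (n + 1)) (ε := 1 / (n + 1)) hp hr (hhc n)
      (hhpos n) (fun s => ?_) (hn0 n) (fun s hs => ?_) ?_
    · exact add_le_add (hC s) (mul_le_of_le_one_right (hn0 n).le (hh0le s))
    · simp only [hh, hh0eq s hs, mul_one]
      linarith [abs_nonneg (φ n s)]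
    · have e1 : Integrable fun s => |φ n s| * Real.exp s := by
        refine Continuous.integrable_of_hasCompactSupport ((hφc n).abs.mul Real.continuous_exp) ?_
        exact HasCompactSupport.mul_right (hφs n).norm
      have := e1.add (hh0i.const_mul (1 / ((n : ℝ) + 1)))
      refine this.congr (Eventually.of_forall fun s => ?_)
      simp only [hh, Pi.add_apply]
      ring
  have hFatou : ∀ t, ∫⁻ s in Iic t, g s ∂expMeasure ≤
      liminf (fun k => ∫⁻ s in Iic t, ENNReal.ofReal (h (ns k) s) ∂expMeasure) atTop := by
    intro t
    refine le_trans (le_of_eq ?_) (lintegral_liminf_le fun k =>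
      (hhc (ns k)).measurable.ennreal_ofReal)
    refine lintegral_congr_ae (ae_restrict_of_ae ?_)
    filter_upwards [hae, hfg] with s hs hs'
    rw [← hs']
    exact ((ENNReal.tendsto_ofReal hs).liminf_eq).symm
  have hq0 : 0 < p * (r + 1) := by positivity
  calc _ ≤ ∫⁻ t, liminf (fun k => (∫⁻ s in Iic t, ENNReal.ofReal (h (ns k) s) ∂expMeasure) ^
          (p * (r + 1)) * ENNReal.ofReal (Real.exp (-((p - 1) * (r + 1)) * t))) atTop := by
        refine lintegral_mono fun t => ?_
        have hm : Monotone fun x : ℝ≥0∞ => x ^ (p * (r + 1)) *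
            ENNReal.ofReal (Real.exp (-((p - 1) * (r + 1)) * t)) := fun x y hxy => by
          dsimp only
          gcongr
        refine (hm (hFatou t)).trans_eq ?_
        refine hm.map_liminf_of_continuousAt _ ?_
        exact (ENNReal.continuous_mul_const ENNReal.ofReal_ne_top).continuousAt.comp
          (ENNReal.continuous_rpow_const.continuousAt)
    _ ≤ liminf (fun k => ∫⁻ t, (∫⁻ s in Iic t, ENNReal.ofReal (h (ns k) s) ∂expMeasure) ^
          (p * (r + 1)) * ENNReal.ofReal (Real.exp (-((p - 1) * (r + 1)) * t))) atTop := by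
        refine lintegral_liminf_le fun k => ?_
        refine Measurable.mul (Measurable.pow_const ?_ _) (by fun_prop)
        have : Monotone fun t => ∫⁻ s in Iic t, ENNReal.ofReal (h (ns k) s) ∂expMeasure :=
          fun a b hab => lintegral_mono_set (Iic_subset_Iic.2 hab)
        exact this.measurable
    _ ≤ liminf (fun k => ENNReal.ofReal (1 / ((p - 1) * (r + 1)) *
        (∫ s, blissDensity r (p * (r + 1) / r) 1 s) ^ (-r)) *
        ((eLpNorm f (ENNReal.ofReal p) expMeasure +
          eLpNorm (h (ns k) - f) (ENNReal.ofReal p) expMeasure) ^ p) ^ (r + 1)) atTop := by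
      refine liminf_le_liminf (Eventually.of_forall fun k => (hreg (ns k)).trans ?_)
      gcongr
      exact hnle (ns k)
    _ = _ := by
      rw [← hfn]
      refine Tendsto.liminf_eq ?_
      refine ENNReal.Tendsto.const_mul ?_ (Or.inr ENNReal.ofReal_ne_top)
      exact ((ENNReal.continuous_rpow_const.tendsto _).comp
        ((ENNReal.continuous_rpow_const.tendsto _).comp (hnlim.comp hns.tendsto_atTop)))

variable {α β : Type*} [MeasurableSpace α] [MeasurableSpace β]

/-- Converse of Hölder's inequality. -/
theorem lintegral_rpow_le_of_forall_lintegral_mul_le {ν : Measure α} [SigmaFinite ν] {p q : ℝ}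
    (hpq : p.HolderConjugate q) {G : α → ℝ≥0∞} (hG : Measurable G) {K : ℝ≥0∞}
    (h : ∀ w : α → ℝ≥0∞, Measurable w →
      ∫⁻ x, w x * G x ∂ν ≤ (∫⁻ x, w x ^ q ∂ν) ^ (1 / q) * K) :
    (∫⁻ x, G x ^ p ∂ν) ^ (1 / p) ≤ K := by
  have hp0 : 0 < p := hpq.pos
  have hq0 : 0 < q := hpq.symm.pos
  have hp1 : 0 < p - 1 := sub_pos.2 hpq.lt
  set H : ℕ → α → ℝ≥0∞ := fun k => (spanningSets ν k).indicator fun x => min (G x) k with hH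
  have hHm : ∀ k, Measurable (H k) := fun k =>
    (hG.min measurable_const).indicator (measurableSet_spanningSets ν k)
  have hHG : ∀ k x, H k x ≤ G x := fun k x =>
    (indicator_le_self _ _ x).trans (min_le_left _ _)
  have hfin : ∀ k, ∫⁻ x, H k x ^ p ∂ν ≠ ∞ := fun k => by
    have h1 : ∫⁻ x, H k x ^ p ∂ν ≤
        ∫⁻ x, (spanningSets ν k).indicator (fun _ => (k : ℝ≥0∞) ^ p) x ∂ν := by
      refine lintegral_mono fun x => ?_
      by_cases hx : x ∈ spanningSets ν k
      · simp only [hH, indicator_of_mem hx]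
        gcongr
        exact min_le_right _ _
      · simp [hH, indicator_of_notMem hx, hp0]
    rw [lintegral_indicator_const (measurableSet_spanningSets ν k)] at h1
    refine ne_top_of_le_ne_top (ENNReal.mul_ne_top ?_ (measure_spanningSets_lt_top ν k).ne) h1
    exact ENNReal.rpow_ne_top_of_nonneg hp0.le (ENNReal.natCast_ne_top k)
  have hle : ∀ k, (∫⁻ x, H k x ^ p ∂ν) ≤ K ^ p := fun k => by
    have h1 := h (fun x => H k x ^ (p - 1)) ((hHm k).pow_const _)
    have h2 : ∀ x, (H k x ^ (p - 1)) ^ q = H k x ^ p := fun x => by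
      rw [← ENNReal.rpow_mul, hpq.sub_one_mul_conj]
    have h3 : ∫⁻ x, H k x ^ p ∂ν ≤ ∫⁻ x, H k x ^ (p - 1) * G x ∂ν := by
      refine lintegral_mono fun x => ?_
      calc H k x ^ p = H k x ^ ((p - 1) + 1) := by rw [sub_add_cancel]
        _ = H k x ^ (p - 1) * H k x := by
          rw [ENNReal.rpow_add_of_nonneg _ _ hp1.le zero_le_one, ENNReal.rpow_one]
        _ ≤ _ := by gcongr; exact hHG k x
    simp only [h2] at h1
    have h4 := h3.trans h1
    set I := ∫⁻ x, H k x ^ p ∂ν with hI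
    rcases eq_or_ne I 0 with h0 | h0
    · simp [h0]
    have h5 : I = I ^ (1 / q) * I ^ (1 / p) := by
      rw [← ENNReal.rpow_add _ _ h0 (hfin k), one_div, one_div, add_comm,
        hpq.inv_add_inv_eq_one, ENNReal.rpow_one]
    have h6 : I ^ (1 / p) ≤ K := by
      refine (ENNReal.mul_le_mul_iff_right (a := I ^ (1 / q)) ?_ ?_).1 (h5 ▸ h4)
      · simp [h0, hq0.le]
      · exact ENNReal.rpow_ne_top_of_nonneg (by positivity) (hfin k)
    have := ENNReal.rpow_le_rpow h6 hp0.le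
    rwa [← ENNReal.rpow_mul, one_div_mul_cancel hp0.ne', ENNReal.rpow_one] at this
  have hlim : ∀ x, Tendsto (fun k => H k x) atTop (𝓝 (G x)) := fun x => by
    have h1 : Tendsto (fun k : ℕ => min (G x) k) atTop (𝓝 (min (G x) ∞)) :=
      tendsto_const_nhds.min ENNReal.tendsto_nat_nhds_top
    rw [min_top_right] at h1
    refine h1.congr' ?_
    filter_upwards [eventually_ge_atTop (spanningSetsIndex ν x)] with k hk
    have : x ∈ spanningSets ν k := mem_spanningSets_of_index_le ν x hk
    simp [hH, this]
  have hF : ∫⁻ x, G x ^ p ∂ν ≤ K ^ p := by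
    calc ∫⁻ x, G x ^ p ∂ν = ∫⁻ x, liminf (fun k => H k x ^ p) atTop ∂ν := by
          congr 1
          ext x
          exact ((ENNReal.continuous_rpow_const.tendsto _).comp (hlim x)).liminf_eq.symm
      _ ≤ liminf (fun k => ∫⁻ x, H k x ^ p ∂ν) atTop :=
        lintegral_liminf_le fun k => (hHm k).pow_const _
      _ ≤ liminf (fun _ => K ^ p) (atTop : Filter ℕ) := liminf_le_liminf (Eventually.of_forall hle)
      _ = K ^ p := liminf_const _
  have := ENNReal.rpow_le_rpow hF (by positivity : 0 ≤ 1 / p)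
  rwa [← ENNReal.rpow_mul, mul_one_div_cancel hp0.ne', ENNReal.rpow_one] at this

/-- Minkowski's integral inequality. -/
theorem lintegral_lintegral_rpow_le {μ : Measure α} {ν : Measure β} [SigmaFinite μ] [SFinite ν]
    {p : ℝ} (hp : 1 < p) {f : α → β → ℝ≥0∞} (hf : Measurable (Function.uncurry f)) :
    (∫⁻ x, (∫⁻ y, f x y ∂ν) ^ p ∂μ) ^ (1 / p) ≤ ∫⁻ y, (∫⁻ x, f x y ^ p ∂μ) ^ (1 / p) ∂ν := by
  have hpq := Real.HolderConjugate.conjExponent hp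
  refine lintegral_rpow_le_of_forall_lintegral_mul_le hpq hf.lintegral_prod_right
    fun w hw => ?_
  calc ∫⁻ x, w x * ∫⁻ y, f x y ∂ν ∂μ = ∫⁻ x, ∫⁻ y, w x * f x y ∂ν ∂μ := by
        refine lintegral_congr fun x => ?_
        rw [lintegral_const_mul _ (by fun_prop)]
    _ = ∫⁻ y, ∫⁻ x, w x * f x y ∂μ ∂ν := by
        refine lintegral_lintegral_swap ?_
        exact ((hw.comp measurable_fst).mul hf).aemeasurable
    _ ≤ ∫⁻ y, (∫⁻ x, w x ^ p.conjExponent ∂μ) ^ (1 / p.conjExponent) *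
          (∫⁻ x, f x y ^ p ∂μ) ^ (1 / p) ∂ν := by
        refine lintegral_mono fun y => ?_
        exact ENNReal.lintegral_mul_le_Lp_mul_Lq μ hpq.symm hw.aemeasurable
          (hf.comp measurable_prodMk_right).aemeasurable
    _ = _ := by
        refine lintegral_const_mul _ ?_
        refine Measurable.pow_const ?_ _
        exact Measurable.lintegral_prod_left' (f := fun z : α × β => f z.1 z.2 ^ p) (hf.pow_const p)

/-- Averaging over the fibres of a map decreases the `L^p` norm. -/
theorem exists_fiber_average {μ : Measure α} [SFinite μ] {ν : Measure β} [SigmaFinite ν]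
    {φ : α → β} (hφ : MeasurePreserving φ μ ν) {p : ℝ} (hp : 1 < p) {f : α → ℝ≥0∞}
    (hf : Measurable f) :
    ∃ g : β → ℝ≥0∞, Measurable g ∧
      (∀ A, MeasurableSet A → ∫⁻ x in φ ⁻¹' A, f x ∂μ = ∫⁻ s in A, g s ∂ν) ∧
      ∫⁻ s, g s ^ p ∂ν ≤ ∫⁻ x, f x ^ p ∂μ := by
  have hp0 : 0 < p := by linarith
  have hpq := Real.HolderConjugate.conjExponent hp
  set ρ := (μ.withDensity f).map φ with hρ
  have hac : ρ ≪ ν := by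
    rw [← hφ.map_eq]
    exact (withDensity_absolutelyContinuous μ f).map hφ.measurable
  have hρν : ν.withDensity (ρ.rnDeriv ν) = ρ := Measure.withDensity_rnDeriv_eq ρ ν hac
  have hgm := Measure.measurable_rnDeriv ρ ν
  refine ⟨ρ.rnDeriv ν, hgm, fun A hA => ?_, ?_⟩
  · rw [← withDensity_apply _ hA, hρν, hρ, Measure.map_apply hφ.measurable hA,
      withDensity_apply _ (hφ.measurable hA)]
  · have key : (∫⁻ s, ρ.rnDeriv ν s ^ p ∂ν) ^ (1 / p) ≤ (∫⁻ x, f x ^ p ∂μ) ^ (1 / p) := by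
      refine lintegral_rpow_le_of_forall_lintegral_mul_le hpq hgm fun w hw => ?_
      calc ∫⁻ s, w s * ρ.rnDeriv ν s ∂ν = ∫⁻ s, w s ∂ρ := by
            conv_rhs => rw [← hρν]
            rw [lintegral_withDensity_eq_lintegral_mul _ hgm hw]
            simp only [Pi.mul_apply, mul_comm]
        _ = ∫⁻ x, w (φ x) * f x ∂μ := by
            rw [hρ, lintegral_map hw hφ.measurable,
              lintegral_withDensity_eq_lintegral_mul μ hf (g := fun x => w (φ x))
                (hw.comp hφ.measurable)]
            simp only [Pi.mul_apply, mul_comm]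
        _ ≤ (∫⁻ x, w (φ x) ^ p.conjExponent ∂μ) ^ (1 / p.conjExponent) *
              (∫⁻ x, f x ^ p ∂μ) ^ (1 / p) :=
            ENNReal.lintegral_mul_le_Lp_mul_Lq μ hpq.symm (hw.comp hφ.measurable).aemeasurable
              hf.aemeasurable
        _ = _ := by rw [hφ.lintegral_comp (hw.pow_const p.conjExponent)]
    exact (ENNReal.rpow_le_rpow_iff (by positivity)).1 key

/-- Bliss' inequality transported along a map with push-forward `expMeasure`. -/
theorem bliss_lintegral_comp {μ : Measure α} [SFinite μ] {φ : α → ℝ}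
    (hφ : MeasurePreserving φ μ expMeasure) {p r : ℝ} (hp : 1 < p) (hr : 0 < r)
    {f : α → ℝ≥0∞} (hf : Measurable f) :
    ∫⁻ x, (∫⁻ y in φ ⁻¹' Iio (φ x), f y ∂μ) ^ (p * (r + 1)) *
        ENNReal.ofReal (Real.exp (-((p - 1) * (r + 1) + 1) * φ x)) ∂μ ≤
      ENNReal.ofReal (1 / ((p - 1) * (r + 1)) *
        (∫ s, blissDensity r (p * (r + 1) / r) 1 s) ^ (-r)) *
        (∫⁻ x, f x ^ p ∂μ) ^ (r + 1) := by
  have hr1 : 0 < r + 1 := by linarith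
  have hp1 : 0 < p - 1 := by linarith
  have hN : 1 < p * (r + 1) / r := by rw [lt_div_iff₀ hr]; nlinarith
  have hK : 0 < ∫ s, blissDensity r (p * (r + 1) / r) 1 s :=
    have hi := integrable_blissDensity (r := r) (N := p * (r + 1) / r) (a := 1) (by linarith)
      one_pos (by rw [mul_div_cancel₀ _ hr.ne']; nlinarith)
    (setIntegral_Iic_pos (continuous_blissDensity _ _ _) hi (blissDensity_pos _ _ _) 0).trans
      (setIntegral_Iic_lt (continuous_blissDensity _ _ _) hi (blissDensity_pos _ _ _) 0)
  by_cases hI : ∫⁻ x, f x ^ p ∂μ = ∞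
  · rw [hI, ENNReal.top_rpow_of_pos hr1, ENNReal.mul_top]
    · exact le_top
    · simp only [ne_eq, ENNReal.ofReal_eq_zero, not_le]
      positivity
  obtain ⟨g, hg, hgA, hgp⟩ := exists_fiber_average hφ hp hf
  have hFm : Measurable fun t => ∫⁻ s in Iio t, g s ∂expMeasure :=
    Monotone.measurable fun a b hab => lintegral_mono_set (Iio_subset_Iio hab)
  simp only [fun t => hgA (Iio t) measurableSet_Iio]
  have hm : Measurable fun t => (∫⁻ s in Iio t, g s ∂expMeasure) ^ (p * (r + 1)) *
        ENNReal.ofReal (Real.exp (-((p - 1) * (r + 1) + 1) * t)) :=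
    (hFm.pow_const _).mul (by fun_prop)
  rw [hφ.lintegral_comp hm, lintegral_expMeasure hm]
  calc _ ≤ ∫⁻ t, (∫⁻ s in Iic t, g s ∂expMeasure) ^ (p * (r + 1)) *
        ENNReal.ofReal (Real.exp (-((p - 1) * (r + 1)) * t)) := by
        refine lintegral_mono fun t => ?_
        rw [mul_assoc, ← ENNReal.ofReal_mul (Real.exp_pos _).le, ← Real.exp_add]
        have : -((p - 1) * (r + 1) + 1) * t + t = -((p - 1) * (r + 1)) * t := by ring
        rw [this]
        gcongr
        exact Iio_subset_Iic_self
    _ ≤ _ := bliss_lintegral hp hr hg (ne_top_of_le_ne_top hI hgp)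
    _ ≤ _ := by gcongr

theorem expMeasure_Iio (t : ℝ) : expMeasure (Iio t) = ENNReal.ofReal (Real.exp t) := by
  rw [expMeasure, withDensity_apply _ measurableSet_Iio, setLIntegral_congr Iio_ae_eq_Iic,
    ← ofReal_integral_eq_lintegral_ofReal (integrableOn_exp_Iic t)
      (Eventually.of_forall fun s => (Real.exp_pos s).le), integral_exp_Iic]

variable {E : Type*} [NormedAddCommGroup E] [NormedSpace ℝ E] [FiniteDimensional ℝ E]
  [MeasurableSpace E] (μ : Measure E) [μ.IsAddHaarMeasure]

/-- The logarithm of the volume of the centred ball with `x` on its boundary. -/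
noncomputable def logBallVolume (x : E) : ℝ :=
  Real.log (μ.real (Metric.ball 0 ‖x‖))

theorem measureReal_ball_zero_pos {R : ℝ} (hR : 0 < R) : 0 < μ.real (Metric.ball 0 R) :=
  ENNReal.toReal_pos (Metric.measure_ball_pos μ 0 hR).ne' measure_ball_lt_top.ne

variable [BorelSpace E] [Nontrivial E]

theorem measureReal_ball_zero (R : ℝ) (hR : 0 ≤ R) :
    μ.real (Metric.ball 0 R) = R ^ Module.finrank ℝ E * μ.real (Metric.ball 0 1) := by
  rw [Measure.real, Measure.addHaar_ball μ 0 hR, ENNReal.toReal_mul,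
    ENNReal.toReal_ofReal (by positivity), Measure.real]

theorem measureReal_ball_zero_lt_iff {R S : ℝ} (hR : 0 ≤ R) (hS : 0 ≤ S) :
    μ.real (Metric.ball 0 R) < μ.real (Metric.ball 0 S) ↔ R < S := by
  rw [measureReal_ball_zero μ R hR, measureReal_ball_zero μ S hS,
    mul_lt_mul_iff_left₀ (measureReal_ball_zero_pos μ one_pos),
    pow_lt_pow_iff_left₀ hR hS Module.finrank_pos.ne']

theorem measurable_logBallVolume : Measurable (logBallVolume μ) := by
  have : logBallVolume μ = fun x : E =>
      Real.log (‖x‖ ^ Module.finrank ℝ E * μ.real (Metric.ball 0 1)) := by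
    ext x
    rw [logBallVolume, measureReal_ball_zero μ _ (norm_nonneg x)]
  rw [this]
  fun_prop

theorem exists_measureReal_ball_eq_exp (t : ℝ) :
    ∃ R : ℝ, 0 < R ∧ μ.real (Metric.ball 0 R) = Real.exp t := by
  have hc := measureReal_ball_zero_pos μ one_pos
  have hR : 0 < (Real.exp t / μ.real (Metric.ball 0 1)) ^ (1 / (Module.finrank ℝ E : ℝ)) := by
    positivity
  refine ⟨_, hR, ?_⟩
  rw [measureReal_ball_zero μ _ hR.le, ← Real.rpow_natCast, ← Real.rpow_mul (by positivity),
    one_div_mul_cancel (Nat.cast_ne_zero.2 Module.finrank_pos.ne'), Real.rpow_one,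
    div_mul_cancel₀ _ hc.ne']

theorem logBallVolume_preimage_Iio_ae_eq {R t : ℝ} (hR : 0 < R)
    (ht : μ.real (Metric.ball 0 R) = Real.exp t) :
    logBallVolume μ ⁻¹' Iio t =ᵐ[μ] Metric.ball 0 R := by
  filter_upwards [compl_mem_ae_iff.2 (measure_singleton (μ := μ) (0 : E))] with x hx
  have hx0 : 0 < ‖x‖ := norm_pos_iff.2 hx
  refine propext ?_
  change logBallVolume μ x < t ↔ x ∈ Metric.ball 0 R
  rw [mem_ball_zero_iff, logBallVolume, Real.log_lt_iff_lt_exp (measureReal_ball_zero_pos μ hx0),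
    ← ht, measureReal_ball_zero_lt_iff μ hx0.le hR.le]

theorem measurePreserving_logBallVolume : MeasurePreserving (logBallVolume μ) μ expMeasure := by
  have hm := measurable_logBallVolume μ
  refine ⟨hm, (Measure.ext_of_Ico _ _ fun a b hab => ?_).symm⟩
  have h : ∀ t, μ (logBallVolume μ ⁻¹' Iio t) = ENNReal.ofReal (Real.exp t) := fun t => by
    obtain ⟨R, hR, hRt⟩ := exists_measureReal_ball_eq_exp μ t
    rw [measure_congr (logBallVolume_preimage_Iio_ae_eq μ hR hRt), ← hRt, Measure.real,
      ENNReal.ofReal_toReal measure_ball_lt_top.ne]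
  have hd : Ico a b = Iio b \ Iio a := by
    ext x
    simp
  rw [Measure.map_apply hm measurableSet_Ico, hd, preimage_sdiff,
    measure_sdiff (preimage_mono (Iio_subset_Iio hab.le)) (hm measurableSet_Iio).nullMeasurableSet
      (by rw [h]; exact ENNReal.ofReal_ne_top),
    measure_sdiff (Iio_subset_Iio hab.le) measurableSet_Iio.nullMeasurableSet
      (by rw [expMeasure_Iio]; exact ENNReal.ofReal_ne_top), h, h, expMeasure_Iio, expMeasure_Iio]

/-- The fractional Hardy operator with normalising exponent `a`. -/
noncomputable def fracHardy (a : ℝ) (f : E → ℝ≥0∞) (x : E) : ℝ≥0∞ :=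
  μ (Metric.ball 0 ‖x‖) ^ a * ∫⁻ y in Metric.ball 0 ‖x‖, f y ∂μ

theorem lintegral_fracHardy_rpow_le {p r a : ℝ} (hp : 1 < p) (hr : 0 < r)
    (ha : a * (p * (r + 1)) = -((p - 1) * (r + 1) + 1)) {f : E → ℝ≥0∞} (hf : Measurable f) :
    ∫⁻ x, fracHardy μ a f x ^ (p * (r + 1)) ∂μ ≤
      ENNReal.ofReal (1 / ((p - 1) * (r + 1)) *
        (∫ s, blissDensity r (p * (r + 1) / r) 1 s) ^ (-r)) *
        (∫⁻ x, f x ^ p ∂μ) ^ (r + 1) := by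
  have hq : 0 ≤ p * (r + 1) := by positivity
  refine le_trans (le_of_eq ?_)
    (bliss_lintegral_comp (measurePreserving_logBallVolume μ) hp hr hf)
  refine lintegral_congr_ae ?_
  filter_upwards [compl_mem_ae_iff.2 (measure_singleton (μ := μ) (0 : E))] with x hx
  have hx0 : 0 < ‖x‖ := norm_pos_iff.2 hx
  have hv := measureReal_ball_zero_pos μ hx0
  have he : μ.real (Metric.ball 0 ‖x‖) = Real.exp (logBallVolume μ x) := (Real.exp_log hv).symm
  have hm : μ (Metric.ball 0 ‖x‖) = ENNReal.ofReal (Real.exp (logBallVolume μ x)) := by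
    rw [← he, Measure.real, ENNReal.ofReal_toReal measure_ball_lt_top.ne]
  rw [fracHardy, setLIntegral_congr (logBallVolume_preimage_Iio_ae_eq μ hx0 he),
    ENNReal.mul_rpow_of_nonneg _ _ hq, ← ENNReal.rpow_mul, ha, mul_comm, hm,
    ENNReal.ofReal_rpow_of_pos (Real.exp_pos _), ← Real.exp_mul, mul_comm (logBallVolume μ x)]

theorem lintegral_fracHardy_le {p q β n : ℝ} (hp : 1 < p) (hpq : p < q) (hn : 0 < n)
    (hβ : 0 < β) (hscal : 1 / q = 1 / p - β / n) {f : E → ℝ≥0∞} (hf : Measurable f) :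
    (∫⁻ x, fracHardy μ (β / n - 1) f x ^ q ∂μ) ^ (1 / q) ≤
      ENNReal.ofReal (((p / (p - 1)) / q) ^ (1 / q) *
        ((n / (q * β)) * betaFn (n / (q * β)) (n / ((q / (q - 1)) * β))) ^ (-β / n)) *
        (∫⁻ x, f x ^ p ∂μ) ^ (1 / p) := by
  have hp0 : 0 < p := by linarith
  have hq0 : 0 < q := by linarith
  have hp1 : 0 < p - 1 := by linarith
  have hq1 : 0 < q - 1 := by linarith
  obtain ⟨r, hrd⟩ : ∃ r, r = q / p - 1 := ⟨_, rfl⟩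
  have hr : 0 < r := by rw [hrd, sub_pos, one_lt_div hp0]; exact hpq
  have hqr : p * (r + 1) = q := by rw [hrd]; field_simp; ring
  have hβn : β / n = r / q := by
    have : β / n = 1 / p - 1 / q := by linarith
    rw [this, hrd]
    field_simp
  have h1 : n / (q * β) = 1 / r := by
    have : n / (q * β) = 1 / (q * (β / n)) := by field_simp
    rw [this, hβn, mul_div_cancel₀ _ hq0.ne']
  have h2 : n / ((q / (q - 1)) * β) = q / r - 1 / r := by
    have : n / ((q / (q - 1)) * β) = (q - 1) * (n / (q * β)) := by field_simp
    rw [this, h1]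
    ring
  have hmain := lintegral_fracHardy_rpow_le μ (a := β / n - 1) hp hr
    (by rw [hβn, hqr, sub_mul, div_mul_cancel₀ _ hq0.ne', ← hqr]; ring) hf
  rw [hqr, integral_blissDensity_one_eq_betaFn hr] at hmain
  rw [h1, h2, neg_div]
  set K := 1 / r * betaFn (1 / r) (q / r - 1 / r) with hK
  have hK0 : 0 ≤ K := by
    rw [hK, ← integral_blissDensity_one_eq_betaFn hr]
    exact integral_nonneg fun s => (blissDensity_pos _ _ _ s).le
  have h3 := ENNReal.rpow_le_rpow hmain (by positivity : 0 ≤ 1 / q)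
  rw [ENNReal.mul_rpow_of_nonneg _ _ (by positivity), ← ENNReal.rpow_mul,
    ENNReal.ofReal_rpow_of_nonneg (by positivity) (by positivity),
    Real.mul_rpow (by positivity) (by positivity), ← Real.rpow_mul hK0] at h3
  have e1 : (r + 1) * (1 / q) = 1 / p := by rw [← hqr]; field_simp
  have e2 : 1 / ((p - 1) * (r + 1)) = p / (p - 1) / q := by rw [← hqr]; field_simp
  have e3 : -r * (1 / q) = -(r / q) := by ring
  rwa [e1, e2, e3, ← hβn] at h3

end

section

variable {E : Type*} [NormedAddCommGroup E] [NormedSpace ℝ E] [FiniteDimensional ℝ E]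
  [MeasurableSpace E] (μ : Measure E) [μ.IsAddHaarMeasure]
  {F : Type*} [NormedAddCommGroup F] [NormedSpace ℝ F] [FiniteDimensional ℝ F]
  [MeasurableSpace F] (ν : Measure F) [ν.IsAddHaarMeasure]

theorem lintegral_fracHardy_rpow_le_fracHardy {p : ℝ} (hp : 1 < p) (a : ℝ) {f : E × F → ℝ≥0∞}
    (hf : Measurable f) (x : E) :
    (∫⁻ y₂, fracHardy μ a (fun y₁ => f (y₁, y₂)) x ^ p ∂ν) ^ (1 / p) ≤
      fracHardy μ a (fun y₁ => (∫⁻ y₂, f (y₁, y₂) ^ p ∂ν) ^ (1 / p)) x := by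
  have hp0 : 0 < p := by linarith
  simp only [fracHardy, ENNReal.mul_rpow_of_nonneg _ _ hp0.le]
  rw [lintegral_const_mul _ (hf.lintegral_prod_left'.pow_const p),
    ENNReal.mul_rpow_of_nonneg _ _ (by positivity), ← ENNReal.rpow_mul,
    mul_one_div_cancel hp0.ne', ENNReal.rpow_one]
  gcongr
  exact lintegral_lintegral_rpow_le hp (f := fun y₂ y₁ => f (y₁, y₂)) (hf.comp measurable_swap)

variable [BorelSpace E]

theorem lintegral_lintegral_fracHardy_fracHardy_le {p q a b : ℝ} {A B : ℝ≥0∞} (hp : 1 < p)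
    (hq : 0 < q)
    (hA : ∀ g : E → ℝ≥0∞, Measurable g →
      (∫⁻ x, fracHardy μ a g x ^ q ∂μ) ^ (1 / q) ≤ A * (∫⁻ x, g x ^ p ∂μ) ^ (1 / p))
    (hB : ∀ g : F → ℝ≥0∞, Measurable g →
      (∫⁻ x, fracHardy ν b g x ^ q ∂ν) ^ (1 / q) ≤ B * (∫⁻ x, g x ^ p ∂ν) ^ (1 / p))
    {f : E × F → ℝ≥0∞} (hf : Measurable f) :
    (∫⁻ x₁, ∫⁻ x₂, fracHardy ν b (fun y₂ => fracHardy μ a (fun y₁ => f (y₁, y₂)) x₁) x₂ ^ q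
        ∂ν ∂μ) ^ (1 / q) ≤
      A * B * (∫⁻ y, f y ^ p ∂(μ.prod ν)) ^ (1 / p) := by
  have hp0 : 0 < p := by linarith
  set φ : E → ℝ≥0∞ := fun y₁ => (∫⁻ y₂, f (y₁, y₂) ^ p ∂ν) ^ (1 / p) with hφ
  have hφm : Measurable φ := (hf.pow_const p).lintegral_prod_right'.pow_const _
  have hTm : ∀ x₁, Measurable fun y₂ => fracHardy μ a (fun y₁ => f (y₁, y₂)) x₁ := fun x₁ =>
    hf.lintegral_prod_left'.const_mul _
  have hinner : ∀ x₁,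
      ∫⁻ x₂, fracHardy ν b (fun y₂ => fracHardy μ a (fun y₁ => f (y₁, y₂)) x₁) x₂ ^ q ∂ν ≤
        B ^ q * fracHardy μ a φ x₁ ^ q := fun x₁ => by
    have h1 := (hB _ (hTm x₁)).trans
      (mul_le_mul_right (lintegral_fracHardy_rpow_le_fracHardy μ ν hp a hf x₁) B)
    have h2 := ENNReal.rpow_le_rpow h1 hq.le
    rwa [← ENNReal.rpow_mul, one_div_mul_cancel hq.ne', ENNReal.rpow_one,
      ENNReal.mul_rpow_of_nonneg _ _ hq.le] at h2
  have hφp : ∫⁻ y₁, φ y₁ ^ p ∂μ = ∫⁻ y, f y ^ p ∂(μ.prod ν) := by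
    rw [lintegral_prod _ (hf.pow_const p).aemeasurable]
    simp only [hφ, ← ENNReal.rpow_mul, one_div_mul_cancel hp0.ne', ENNReal.rpow_one]
  have hTφ : Measurable (fracHardy μ a φ) := by
    have h1 : Measurable fun R : ℝ => μ (Metric.ball 0 R) :=
      Monotone.measurable fun R S h => measure_mono (Metric.ball_subset_ball h)
    have h2 : Measurable fun R : ℝ => ∫⁻ y in Metric.ball 0 R, φ y ∂μ :=
      Monotone.measurable fun R S h => lintegral_mono_set (Metric.ball_subset_ball h)
    exact ((h1.comp measurable_norm).pow_const a).mul (h2.comp measurable_norm)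
  calc _ ≤ (∫⁻ x₁, B ^ q * fracHardy μ a φ x₁ ^ q ∂μ) ^ (1 / q) := by
        gcongr with x₁
        exact hinner x₁
    _ = B * (∫⁻ x₁, fracHardy μ a φ x₁ ^ q ∂μ) ^ (1 / q) := by
        rw [lintegral_const_mul _ (hTφ.pow_const q),
          ENNReal.mul_rpow_of_nonneg _ _ (by positivity), ← ENNReal.rpow_mul,
          mul_one_div_cancel hq.ne', ENNReal.rpow_one]
    _ ≤ B * (A * (∫⁻ y₁, φ y₁ ^ p ∂μ) ^ (1 / p)) := by
        gcongr
        exact hA φ hφm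
    _ = _ := by rw [hφp, ← mul_assoc, mul_comm B]

end

theorem prodFracHardy₂_eq_fracHardy {n₁ n₂ : ℕ} (β₁ β₂ : ℝ)
    {f : EuclideanSpace ℝ (Fin n₁) × EuclideanSpace ℝ (Fin n₂) → ℝ≥0∞} (hf : Measurable f)
    (x₁ : EuclideanSpace ℝ (Fin n₁)) (x₂ : EuclideanSpace ℝ (Fin n₂)) :
    prodFracHardy₂ n₁ n₂ β₁ β₂ f (x₁, x₂) =
      fracHardy volume (β₂ / n₂ - 1)
        (fun y₂ => fracHardy volume (β₁ / n₁ - 1) (fun y₁ => f (y₁, y₂)) x₁) x₂ := by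
  simp only [prodFracHardy₂, fracHardy]
  rw [lintegral_const_mul _ hf.lintegral_prod_left', Measure.volume_eq_prod,
    ← Measure.prod_restrict, lintegral_prod_symm' _ hf]
  ring

/-- `L^p → L^q` bound for `𝓗_{β₁,β₂}` on `ℝ^{n₁} × ℝ^{n₂}` with constant `A₁ A₂`. -/
theorem prodFracHardy₂_bound (n₁ n₂ : ℕ) (hn₁ : 1 ≤ n₁) (hn₂ : 1 ≤ n₂)
    (β₁ β₂ p q : ℝ) (hp : 1 < p) (hpq : p < q)
    (hβ₁0 : 0 < β₁) (hβ₁n : β₁ < n₁) (hβ₂0 : 0 < β₂) (hβ₂n : β₂ < n₂)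
    (hscal₁ : 1 / q = 1 / p - β₁ / n₁) (hscal₂ : 1 / q = 1 / p - β₂ / n₂)
    (f : EuclideanSpace ℝ (Fin n₁) × EuclideanSpace ℝ (Fin n₂) → ℝ≥0∞)
    (hf : Measurable f) :
    (∫⁻ x, prodFracHardy₂ n₁ n₂ β₁ β₂ f x ^ q) ^ (1 / q)
      ≤ ENNReal.ofReal
          ((((p / (p - 1)) / q) ^ (1 / q) *
              ((n₁ / (q * β₁)) *
                betaFn (n₁ / (q * β₁)) (n₁ / ((q / (q - 1)) * β₁))) ^ (-β₁ / n₁)) *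
           (((p / (p - 1)) / q) ^ (1 / q) *
              ((n₂ / (q * β₂)) *
                betaFn (n₂ / (q * β₂)) (n₂ / ((q / (q - 1)) * β₂))) ^ (-β₂ / n₂))) *
        (∫⁻ x, f x ^ p) ^ (1 / p) := by
  have : Nonempty (Fin n₁) := ⟨⟨0, hn₁⟩⟩
  have : Nonempty (Fin n₂) := ⟨⟨0, hn₂⟩⟩
  have hq : 0 < q := by linarith
  have hn₁' : (0 : ℝ) < n₁ := Nat.cast_pos.2 hn₁
  have hn₂' : (0 : ℝ) < n₂ := Nat.cast_pos.2 hn₂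
  rw [ENNReal.ofReal_mul]
  · refine le_trans ?_ (lintegral_lintegral_fracHardy_fracHardy_le volume volume hp hq
      (fun g hg => lintegral_fracHardy_le volume hp hpq hn₁' hβ₁0 hscal₁ hg)
      (fun g hg => lintegral_fracHardy_le volume hp hpq hn₂' hβ₂0 hscal₂ hg) hf)
    gcongr
    refine (lintegral_prod_le _).trans_eq ?_
    simp only [prodFracHardy₂_eq_fracHardy β₁ β₂ hf]
  · have hp1 : 0 < p - 1 := by linarith
    have hb : 0 ≤ betaFn (n₁ / (q * β₁)) (n₁ / ((q / (q - 1)) * β₁)) :=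
      setIntegral_nonneg measurableSet_Ioo fun t ht =>
        mul_nonneg (Real.rpow_nonneg ht.1.le _) (Real.rpow_nonneg (by linarith [ht.2]) _)
    positivity
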